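/- Let Φ = {Φ_Λ}_{Λ∈𝒞} be a T-invariant interaction potential on X = S^ℤ with ∑_{Λ∋0} ‖Φ_Λ‖ < ∞. Suppose there exist K > 0 and 0 < α ≤ 1 such that ∑_{i=0}^n ∑_{Λ∋0, Λ∩[i+1,∞)≠∅} var(Φ_Λ) ≤ (1−α)·log n + log K for all n ≥ 1, and limsup_{n→∞} n^{1/2}·(∑_{Λ∋0, Λ∩[n+1,∞)≠∅} var(Φ_Λ))^α < K⁻¹·Γ(α). Then Φ has a unique T-invariant Gibbs state. -/

import Mathlib

open MeasureTheory Filter Set Asymptotics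

noncomputable section

namespace GibbsFormal

/-- The configuration space `X = S^ℤ`. -/
abbrev Conf (S : Type) := ℤ → S

variable {S : Type} [Fintype S] [Nonempty S] [DecidableEq S]
  [TopologicalSpace S] [DiscreteTopology S]
  [MeasurableSpace S] [MeasurableSingletonClass S]

/-- The configuration obtained from `x` by replacing its coordinates on `Λ` by `ζ`. -/
def ov (x : Conf S) (Λ : Finset ℤ) (ζ : Λ → S) : Conf S :=
  fun i => if h : i ∈ Λ then ζ ⟨i, h⟩ else x i

/-- The configuration `x'_Λ x_{Λᶜ}`, agreeing with `x'` on `Λ` and with `x` off `Λ`. -/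
def merge (Λ : Finset ℤ) (x' x : Conf S) : Conf S :=
  fun i => if i ∈ Λ then x' i else x i

/-- The configuration `s_n x`. -/
def upd (s : S) (n : ℤ) (x : Conf S) : Conf S :=
  fun i => if i = n then s else x i

/-- The shift `Tⁿ`:  `(Tⁿ x) i = x (i + n)`. -/
def shift (n : ℤ) (x : Conf S) : Conf S := fun i => x (i + n)

/-- The sub-σ-algebra `ℬ_Λ` of the Borel (= product) σ-algebra, generated by
coordinates in `Λ`. -/
def cylSA (Λ : Set ℤ) : MeasurableSpace (Conf S) :=
  MeasurableSpace.comap (fun x => Λ.restrict x) inferInstance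

/-- The cylinder set `[ζ]_Λ`. -/
def cylEvent (Λ : Finset ℤ) (ζ : Λ → S) : Set (Conf S) :=
  {y | ∀ i : Λ, y i = ζ i}

/-- `r_Λ(f) = sup {f x / f y : x_Λ = y_Λ}`. -/
def rSup (Λ : Set ℤ) (f : Conf S → ℝ) : ℝ :=
  sSup {r : ℝ | ∃ x y : Conf S, (∀ i ∈ Λ, x i = y i) ∧ f x / f y = r}

/-- `r̄_Λ(f) = inf {f x / f y : x_Λ = y_Λ}`. -/
def rInf (Λ : Set ℤ) (f : Conf S → ℝ) : ℝ :=
  sInf {r : ℝ | ∃ x y : Conf S, (∀ i ∈ Λ, x i = y i) ∧ f x / f y = r}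

/-- A specification `𝒱 = {φ_Λ}` on `S^ℤ`:  a family of nonnegative Borel functions
satisfying the normalisation and consistency conditions.  (The value on the empty set
is normalised to `1`, which is forced by the unguarded normalisation condition.) -/
structure Specification (A : Type) [Fintype A] [MeasurableSpace A] where
  φ : Finset ℤ → Conf A → ℝ
  nonneg : ∀ Λ x, 0 ≤ φ Λ x
  measurable : ∀ Λ, Measurable (φ Λ)
  sum_one : ∀ (Λ : Finset ℤ) (x : Conf A), ∑ ζ : Λ → A, φ Λ (ov x Λ ζ) = 1
  consistent : ∀ (K Λ : Finset ℤ), K ⊆ Λ → ∀ x : Conf A,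
    φ Λ x = φ K x * ∑ ζ : K → A, φ Λ (ov x K ζ)

/-- A positive specification. -/
def Specification.Positive (V : Specification S) : Prop := ∀ Λ x, 0 < V.φ Λ x

/-- A continuous specification. -/
def Specification.IsCont (V : Specification S) : Prop := ∀ Λ, Continuous (V.φ Λ)

/-- A `T`-invariant specification: `φ_{n+Λ}(x) = φ_Λ(Tⁿ x)`. -/
def Specification.TInvariant (V : Specification S) : Prop :=
  ∀ (n : ℤ) (Λ : Finset ℤ) (x : Conf S),
    V.φ (Λ.image fun i => n + i) x = V.φ Λ (shift n x)

/-- The DLR (Gibbs) condition for a family `φfam` of conditional probabilities: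
for each finite nonempty `Λ` and each pattern `ζ` on `Λ`, the conditional probability
of the cylinder `[ζ]_Λ` given `ℬ_{Λᶜ}` is `x ↦ φfam Λ (ζ x_{Λᶜ})`, `μ`-a.e. -/
def GibbsCond (φfam : Finset ℤ → Conf S → ℝ) (μ : Measure (Conf S)) : Prop :=
  ∀ (Λ : Finset ℤ), Λ.Nonempty → ∀ ζ : Λ → S,
    (fun x => φfam Λ (ov x Λ ζ)) =ᵐ[μ]
      μ[(cylEvent Λ ζ).indicator (fun _ => (1 : ℝ)) | cylSA ((↑Λ : Set ℤ)ᶜ)]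

/-- `μ` is a Gibbs state for the specification `V`. -/
def IsGibbs (V : Specification S) (μ : Measure (Conf S)) : Prop :=
  IsProbabilityMeasure μ ∧ GibbsCond V.φ μ

/-- `g ∈ 𝒢_X`: a nonnegative bounded `ℬ_{ℤ⁻}`-measurable function with
`∑_{s ∈ S} g (s_0 x) = 1`. -/
def MemG (g : Conf S → ℝ) : Prop :=
  (∃ C, ∀ x, |g x| ≤ C) ∧ (∀ x, 0 ≤ g x) ∧
    Measurable[cylSA (Set.Iic (0 : ℤ))] g ∧
    ∀ x : Conf S, ∑ s : S, g (upd s 0 x) = 1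

/-- `μ` is a `g`-chain: for every `n` the conditional probability of the symbol at
site `n` given `ℬ_{(-∞,n-1]}` is `x ↦ g (Tⁿ (s_n x))`, `μ`-a.e. -/
def IsGChain (g : Conf S → ℝ) (μ : Measure (Conf S)) : Prop :=
  IsProbabilityMeasure μ ∧ ∀ (n : ℤ) (s : S),
    (fun x => g (shift n (upd s n x))) =ᵐ[μ]
      μ[({y : Conf S | y n = s}).indicator (fun _ => (1 : ℝ)) | cylSA (Set.Iic (n - 1))]

/-- The probability `π^𝒱_{[0,n]}([x]_{{0}} | x)`. -/
def piG (V : Specification S) (n : ℕ) (x : Conf S) : ℝ :=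
  ∑ ζ : (Finset.Icc (0 : ℤ) (n : ℤ)) → S,
    V.φ (Finset.Icc (0 : ℤ) (n : ℤ)) (ov x (Finset.Icc (0 : ℤ) (n : ℤ)) ζ) *
      (if ov x (Finset.Icc (0 : ℤ) (n : ℤ)) ζ 0 = x 0 then 1 else 0)

/-- A specification sequence of the form `{([0,n], f_n)}`: each `f_n` is bounded,
strictly positive and `ℬ_{[0,n-1]ᶜ}`-measurable. -/
def IsSpecSeq (f : ℕ → Conf S → ℝ) : Prop :=
  ∀ n : ℕ, (∃ C, ∀ x, f n x ≤ C) ∧ (∀ x, 0 < f n x) ∧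
    Measurable[cylSA ((Set.Ico (0 : ℤ) (n : ℤ))ᶜ)] (f n)

/-- `{([0,n], f_n)}` is a specification sequence for the family `φfam`. -/
def IsSpecSeqForFam (φfam : Finset ℤ → Conf S → ℝ) (f : ℕ → Conf S → ℝ) : Prop :=
  IsSpecSeq f ∧ ∀ (n : ℕ) (x : Conf S),
    φfam (Finset.Icc (0 : ℤ) (n : ℤ)) x =
      (∏ j ∈ Finset.range (n + 1), f j x) /
        ∑ ζ : (Finset.Icc (0 : ℤ) (n : ℤ)) → S,
          ∏ j ∈ Finset.range (n + 1), f j (ov x (Finset.Icc (0 : ℤ) (n : ℤ)) ζ)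

/-- `{([0,n], f_n)}` is a specification sequence for the specification `V`. -/
def IsSpecSeqFor (V : Specification S) (f : ℕ → Conf S → ℝ) : Prop :=
  IsSpecSeqForFam V.φ f

/-- The operator `L_{m,n} h (x) = ∑_{y ∈ [x]_{[m,n]ᶜ}} (∏_{i=m}^n f_i y) · h y`. -/
def Lop (f : ℕ → Conf S → ℝ) (m n : ℕ) (h : Conf S → ℝ) (x : Conf S) : ℝ :=
  ∑ ζ : (Finset.Icc (m : ℤ) (n : ℤ)) → S,
    (∏ i ∈ Finset.Icc m n, f i (ov x (Finset.Icc (m : ℤ) (n : ℤ)) ζ)) *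
      h (ov x (Finset.Icc (m : ℤ) (n : ℤ)) ζ)

/-- The ratio bounds `ρ_k^{(n)}(x,y)` (with `ρ_{-1}^{(n)}` for negative `k`). -/
def rho (f : ℕ → Conf S → ℝ) (k : ℤ) (n : ℕ) (x y : Conf S) : ℝ :=
  if k < 0 then
    sInf {r : ℝ | ∃ m : ℕ,
      Lop f m (m + n) (fun _ => 1) x / Lop f m (m + n) (fun _ => 1) y = r}
  else
    sInf {r : ℝ | ∃ (m : ℕ) (ζ : (Finset.Icc (m : ℤ) ((m : ℤ) + k)) → S),
      Lop f m (m + n) ((cylEvent (Finset.Icc (m : ℤ) ((m : ℤ) + k)) ζ).indicator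
          fun _ => 1) x /
        Lop f m (m + n) ((cylEvent (Finset.Icc (m : ℤ) ((m : ℤ) + k)) ζ).indicator
          fun _ => 1) y = r}

/-- A `T`-invariant interaction potential `Φ = {Φ_Λ}`. -/
structure Potential (A : Type) [Fintype A] [MeasurableSpace A] where
  Φ : Finset ℤ → Conf A → ℝ
  measurable : ∀ Λ : Finset ℤ, Λ.Nonempty → Measurable[cylSA (↑Λ : Set ℤ)] (Φ Λ)
  bounded : ∀ Λ : Finset ℤ, ∃ C, ∀ x, |Φ Λ x| ≤ C
  invariant : ∀ (n : ℤ) (Λ : Finset ℤ), Λ.Nonempty → ∀ x : Conf A,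
    Φ (Λ.image fun i => n + i) x = Φ Λ (shift n x)

/-- `var(h) = sup h − inf h`. -/
def pvar (h : Conf S → ℝ) : ℝ := (⨆ x, h x) - ⨅ x, h x

/-- `‖h‖ = sup |h|`. -/
def pnorm (h : Conf S → ℝ) : ℝ := ⨆ x, |h x|

/-- `∑_{Λ ∋ 0} ‖Φ_Λ‖ < ∞`. -/
def NormSummable (P : Potential S) : Prop :=
  Summable fun Λ : {Λ : Finset ℤ // (0 : ℤ) ∈ Λ} => pnorm (P.Φ ↑Λ)

/-- `∑_{Λ ∋ 0, Λ ∩ [n,∞) ≠ ∅} var(Φ_Λ)`. -/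
def varTail (P : Potential S) (n : ℕ) : ℝ :=
  ∑' Λ : {Λ : Finset ℤ // (0 : ℤ) ∈ Λ ∧ ∃ i ∈ Λ, (n : ℤ) ≤ i}, pvar (P.Φ ↑Λ)

/-- The Hamiltonian `H_Λ(x) = ∑_{K ∩ Λ ≠ ∅} Φ_K(x)`. -/
def HPot (P : Potential S) (Λ : Finset ℤ) (x : Conf S) : ℝ :=
  ∑' K : {K : Finset ℤ // (K ∩ Λ).Nonempty}, P.Φ ↑K x

/-- The specification `𝒱_Φ` associated with an interaction potential. -/
def potPhi (P : Potential S) (Λ : Finset ℤ) (x : Conf S) : ℝ :=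
  Real.exp (-HPot P Λ x) / ∑ ζ : Λ → S, Real.exp (-HPot P Λ (ov x Λ ζ))

/-- `μ` is a Gibbs state for the potential `P`. -/
def IsGibbsPot (P : Potential S) (μ : Measure (Conf S)) : Prop :=
  IsProbabilityMeasure μ ∧ GibbsCond (potPhi P) μ

/-- `(T,μ)` is Bernoulli: the shift on `(S^ℤ, μ)` is measure-theoretically isomorphic
(mod 0) to the shift on `A^ℤ` carrying an i.i.d. product probability measure for some
finite alphabet `A` (wlog `A = Fin m`). -/
def IsBernoulliSystem (μ : Measure (Conf S)) : Prop :=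
  ∃ (m : ℕ) (p : Fin m → ENNReal) (ν : Measure (ℤ → Fin m)),
    IsProbabilityMeasure ν ∧ (∑ a, p a = 1) ∧
    (∀ (Λ : Finset ℤ) (ζ : Λ → Fin m),
      ν {y : ℤ → Fin m | ∀ i : Λ, y ↑i = ζ i} = ∏ i : Λ, p (ζ i)) ∧
    ∃ (θ : Conf S → ℤ → Fin m) (θinv : (ℤ → Fin m) → Conf S),
      Measurable θ ∧ Measurable θinv ∧ μ.map θ = ν ∧
      (∀ᵐ x ∂μ, θ (shift 1 x) = fun i => θ x (i + 1)) ∧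
      (∀ᵐ x ∂μ, θinv (θ x) = x) ∧ (∀ᵐ y ∂ν, θ (θinv y) = y)

/-- The recursively defined quantities `p_k^{(n)}` of Lemma 3.3 (`k = -1` is encoded
by any negative argument). -/
def pSeq (v : ℕ → ℝ) : ℕ → ℤ → ℝ
  | 0, k => if k < 0 then 1 else v 0
  | n + 1, k =>
    if k < 0 then 1
    else v k.toNat * pSeq v n (k - 1) +
      ∑ j ∈ Finset.Ico k.toNat (n + 1), (v (j + 1) - v j) * pSeq v n (j : ℤ)


section Renewal

/-- The renewal sequence `exp (-(t 0 + ⋯ + t (n - 1)))`. -/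
def renewal (t : ℕ → ℝ) (n : ℕ) : ℝ := Real.exp (-∑ d ∈ Finset.range n, t d)

lemma renewal_zero (t : ℕ → ℝ) : renewal t 0 = 1 := by simp [renewal]

lemma renewal_pos (t : ℕ → ℝ) (n : ℕ) : 0 < renewal t n := Real.exp_pos _

lemma renewal_succ (t : ℕ → ℝ) (n : ℕ) :
    renewal t (n + 1) = Real.exp (-t n) * renewal t n := by
  rw [renewal, renewal, Finset.sum_range_succ, ← Real.exp_add, neg_add_rev]

lemma renewal_antitone {t : ℕ → ℝ} (ht : ∀ d, 0 ≤ t d) : Antitone (renewal t) := by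
  refine antitone_nat_of_succ_le fun n => ?_
  rw [renewal_succ]
  exact mul_le_of_le_one_left (renewal_pos t n).le (by simpa using ht n)

lemma sum_Ioc_sub_pred (F : ℕ → ℝ) {m n : ℕ} (h : m ≤ n) :
    ∑ r ∈ Finset.Ioc m n, (F r - F (r - 1)) = F n - F m := by
  induction n, h using Nat.le_induction with
  | base => simp
  | succ n hmn ih =>
    rw [← Finset.insert_Ioc_right_eq_Ioc_add_one hmn, Finset.sum_insert (by simp), ih]
    simp

lemma sum_mul_add_sum_mul {X : Type*} [Fintype X] (s : Finset ℕ) (φ W A : X → ℝ)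
    (B : ℕ → X → ℝ) (g c : ℝ) (n : ℕ → ℝ) :
    g * c * (∑ x, φ x * A x * W x) + ∑ r ∈ s, g * n r * ∑ x, φ x * B r x * W x =
      ∑ x, g * φ x * W x * (c * A x + ∑ r ∈ s, n r * B r x) := by
  simp_rw [Finset.mul_sum]
  rw [Finset.sum_comm, ← Finset.sum_add_distrib]
  refine Finset.sum_congr rfl fun x _ => ?_
  rw [mul_add, Finset.mul_sum]
  exact congrArg₂ _ (by ring) (Finset.sum_congr rfl fun r _ => by ring)

/-- `φ` is constant on the classes of the relation `R m`. -/
def LevelMeasurable {X : Type*} (R : ℕ → X → X → Prop) (m : ℕ) (φ : X → ℝ) : Prop :=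
  ∀ x y, R m x y → φ x = φ y

/-- The renewal lower bound, in a Markovian form suited to induction: the part of the
sum that has been explored so far is a weight `φ` of level `m`. -/
lemma renewal_bound_aux {X : Type*} [Fintype X] (w f : X → ℝ)
    (R : ℕ → X → X → Prop) (hR : ∀ m m' x y, m ≤ m' → R m' x y → R m x y)
    (N : ℕ) (U : ℕ → ℕ → X → ℝ) (t : ℕ → ℝ) (hw : ∀ x, 0 ≤ w x)
    (hf : ∀ x, 0 ≤ f x)
    (hUmono : ∀ a r x, U a r x ≤ U a (r + 1) x)
    (hUlevel : ∀ a r, LevelMeasurable R r (U a r))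
    (hUbound : ∀ a i x, a ≤ i → i ≤ N → U a N x - U a i x ≤ t (i - a))
    (J : Finset ℕ) (hJ : ∀ j ∈ J, j < N) (C g : ℝ) (hC0 : 0 ≤ C) (hg0 : 0 ≤ g)
    (hC : ∀ j, ∑ i ∈ J with j ≤ i, renewal t (i - j) ≤ C)
    (hg : ∀ j ∈ J, ∀ φ : X → ℝ, (∀ x, 0 ≤ φ x) → LevelMeasurable R j φ →
      g * ∑ x, φ x * (w x * ∏ a ∈ Finset.Ioc j N, Real.exp (U a N x)) ≤
        ∑ x, φ x * (f x * w x * ∏ a ∈ Finset.Ioc j N, Real.exp (U a N x)))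
    (j : ℕ) (hj : j ≤ N) : ∀ m, j ≤ m → m ≤ N →
    ∀ φ : X → ℝ, (∀ x, 0 ≤ φ x) → LevelMeasurable R m φ →
      g * (∑ i ∈ J with m ≤ i, renewal t (i - j)) *
          ∑ x, φ x * (w x * ∏ a ∈ Finset.Ioc j N, Real.exp (U a N x)) ≤
        C * ∑ x, φ x * (f x * w x * ∏ a ∈ Finset.Ioc j N, Real.exp (U a N x)) := by
  have hprod0 : ∀ (j : ℕ) (x : X), 0 ≤ ∏ a ∈ Finset.Ioc j N, Real.exp (U a N x) :=
    fun j x => Finset.prod_nonneg fun _ _ => (Real.exp_pos _).le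
  induction hj using Nat.decreasingInduction with
  | self =>
    intro m hjm _ φ hφ _
    have : J.filter (fun i => m ≤ i) = ∅ := by
      refine Finset.filter_eq_empty_iff.2 fun i hi => ?_
      have := hJ i hi
      omega
    rw [this, Finset.sum_empty, mul_zero, zero_mul]
    exact mul_nonneg hC0 (Finset.sum_nonneg fun x _ =>
      mul_nonneg (hφ x) (mul_nonneg (mul_nonneg (hf x) (hw x)) (hprod0 _ x)))
  | of_succ j hj ih =>
    have key : ∀ m, j + 1 ≤ m → m ≤ N →
        ∀ φ : X → ℝ, (∀ x, 0 ≤ φ x) → LevelMeasurable R m φ →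
        g * (∑ i ∈ J with m ≤ i, renewal t (i - j)) *
            ∑ x, φ x * (w x * ∏ a ∈ Finset.Ioc j N, Real.exp (U a N x)) ≤
          C * ∑ x, φ x * (f x * w x * ∏ a ∈ Finset.Ioc j N, Real.exp (U a N x)) := by
      intro m hjm hmN φ hφ hφl
      set Q : X → ℝ := fun x => ∏ a ∈ Finset.Ioc (j + 1) N, Real.exp (U a N x) with hQ
      set E : ℕ → X → ℝ := fun r x => Real.exp (U (j + 1) r x) with hE
      set n : ℕ → ℝ := fun r => ∑ i ∈ J with r ≤ i, renewal t (i - (j + 1)) with hn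
      have hsplit : ∀ x, ∏ a ∈ Finset.Ioc j N, Real.exp (U a N x) = E N x * Q x := by
        intro x
        have : Finset.Ioc j N = insert (j + 1) (Finset.Ioc (j + 1) N) := by
          ext a; simp only [Finset.mem_Ioc, Finset.mem_insert]; omega
        rw [this, Finset.prod_insert (by simp)]
      have hEN : ∀ x, E N x = E m x + ∑ r ∈ Finset.Ioc m N, (E r x - E (r - 1) x) := by
        intro x
        rw [sum_Ioc_sub_pred (fun r => E r x) hmN]; ring
      have hEd : ∀ r x, 0 ≤ E r x - E (r - 1) x := by
        intro r x
        refine sub_nonneg.2 (Real.exp_le_exp.2 ?_)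
        cases r with
        | zero => simp
        | succ r => simpa using hUmono (j + 1) r x
      have hElev : ∀ r, LevelMeasurable R r (E r) := fun r x y h => by
        simp only [hE, hUlevel (j + 1) r x y h]
      have hm := ih m hjm hmN (fun x => φ x * E m x)
        (fun x => mul_nonneg (hφ x) (Real.exp_pos _).le)
        (fun x y h => by simp only [hφl x y h, hElev m x y h])
      have hr : ∀ r ∈ Finset.Ioc m N, g * n r *
            ∑ x, φ x * (E r x - E (r - 1) x) * (w x * Q x) ≤
          C * ∑ x, φ x * (E r x - E (r - 1) x) * (f x * w x * Q x) := by
        intro r hr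
        obtain ⟨hr1, hr2⟩ := Finset.mem_Ioc.1 hr
        refine ih r (by omega) hr2 (fun x => φ x * (E r x - E (r - 1) x))
          (fun x => mul_nonneg (hφ x) (hEd r x)) (fun x y h => ?_)
        simp only [hφl x y (hR m r x y hr1.le h), hElev r x y h,
          hElev (r - 1) x y (hR (r - 1) r x y (by omega) h)]
      have hpt : ∀ x, (∑ i ∈ J with m ≤ i, renewal t (i - j)) * E N x ≤
          n m * E m x + ∑ r ∈ Finset.Ioc m N, n r * (E r x - E (r - 1) x) := by
        intro x
        have hswap : ∑ r ∈ Finset.Ioc m N, n r * (E r x - E (r - 1) x) =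
            ∑ i ∈ J with m ≤ i, renewal t (i - (j + 1)) * (E i x - E m x) := by
          have h1 : ∀ r ∈ Finset.Ioc m N, n r * (E r x - E (r - 1) x) =
              ∑ i ∈ J with m ≤ i, if r ≤ i then
                renewal t (i - (j + 1)) * (E r x - E (r - 1) x) else 0 := by
            intro r hr
            have hr1 := (Finset.mem_Ioc.1 hr).1
            rw [← Finset.sum_filter, Finset.filter_filter, hn, Finset.sum_mul]
            refine Finset.sum_congr (Finset.filter_congr fun i _ => ?_) fun _ _ => rfl
            omega
          rw [Finset.sum_congr rfl h1, Finset.sum_comm]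
          refine Finset.sum_congr rfl fun i hi => ?_
          obtain ⟨hiJ, hmi⟩ := Finset.mem_filter.1 hi
          rw [← Finset.sum_filter, ← sum_Ioc_sub_pred (fun r => E r x) hmi, Finset.mul_sum]
          refine Finset.sum_congr ?_ fun _ _ => rfl
          have := hJ i hiJ
          ext r; simp only [Finset.mem_filter, Finset.mem_Ioc]; omega
        rw [hswap, hn, Finset.sum_mul, Finset.sum_mul, ← Finset.sum_add_distrib]
        refine Finset.sum_le_sum fun i hi => ?_
        obtain ⟨hiJ, hmi⟩ := Finset.mem_filter.1 hi
        have hiN := hJ i hiJ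
        have hs : i - j = (i - (j + 1)) + 1 := by omega
        have hle : Real.exp (-t (i - (j + 1))) * E N x ≤ E i x := by
          rw [hE, ← Real.exp_add]
          refine Real.exp_le_exp.2 ?_
          have := hUbound (j + 1) i x (by omega) hiN.le
          linarith
        rw [hs, renewal_succ]
        nlinarith [mul_le_mul_of_nonneg_left hle (renewal_pos t (i - (j + 1))).le]
      have hL : g * (∑ i ∈ J with m ≤ i, renewal t (i - j)) *
            ∑ x, φ x * (w x * ∏ a ∈ Finset.Ioc j N, Real.exp (U a N x)) ≤
          g * n m * (∑ x, φ x * E m x * (w x * Q x)) + ∑ r ∈ Finset.Ioc m N, g * n r *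
            ∑ x, φ x * (E r x - E (r - 1) x) * (w x * Q x) := by
        rw [sum_mul_add_sum_mul, Finset.mul_sum]
        refine Finset.sum_le_sum fun x _ => ?_
        rw [hsplit]
        have h0 : 0 ≤ g * φ x * (w x * Q x) :=
          mul_nonneg (mul_nonneg hg0 (hφ x)) (mul_nonneg (hw x) (hprod0 _ x))
        calc _ = g * φ x * (w x * Q x) *
              ((∑ i ∈ J with m ≤ i, renewal t (i - j)) * E N x) := by ring
          _ ≤ _ := mul_le_mul_of_nonneg_left (hpt x) h0
      refine hL.trans ((add_le_add hm (Finset.sum_le_sum hr)).trans (le_of_eq ?_))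
      have := sum_mul_add_sum_mul (Finset.Ioc m N) φ (fun x => f x * w x * Q x) (E m)
        (fun r x => E r x - E (r - 1) x) C 1 (fun _ => 1)
      simp only [mul_one, one_mul] at this
      refine this.trans ?_
      rw [Finset.mul_sum]
      refine Finset.sum_congr rfl fun x _ => ?_
      rw [hsplit, hEN]
      ring
    intro m hjm hmN φ hφ hφl
    rcases hjm.eq_or_lt with rfl | hlt
    · by_cases hjJ : j ∈ J
      · have h1 := hg j hjJ φ hφ hφl
        have h2 : 0 ≤ ∑ x, φ x * (w x * ∏ a ∈ Finset.Ioc j N, Real.exp (U a N x)) :=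
          Finset.sum_nonneg fun x _ => mul_nonneg (hφ x) (mul_nonneg (hw x) (hprod0 _ x))
        calc _ = (∑ i ∈ J with j ≤ i, renewal t (i - j)) *
              (g * ∑ x, φ x * (w x * ∏ a ∈ Finset.Ioc j N, Real.exp (U a N x))) := by ring
          _ ≤ C * (g * ∑ x, φ x * (w x * ∏ a ∈ Finset.Ioc j N, Real.exp (U a N x))) :=
            mul_le_mul_of_nonneg_right (hC j) (mul_nonneg hg0 h2)
          _ ≤ _ := mul_le_mul_of_nonneg_left h1 hC0
      · have : J.filter (fun i => j ≤ i) = J.filter (fun i => j + 1 ≤ i) := by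
          refine Finset.filter_congr fun i hi => ?_
          have : i ≠ j := fun h => hjJ (h ▸ hi)
          omega
        rw [this]
        exact key (j + 1) le_rfl hj φ hφ
          fun x y h => hφl x y (hR j (j + 1) x y (by omega) h)
    · exact key m hlt hmN φ hφ hφl

/-- The renewal lower bound: if `f` is at least `g` on average after every renewal time
in `J`, then it is at least `g (∑ i ∈ J, renewal t i) / C` on average. -/
lemma renewal_bound {X : Type*} [Fintype X] (w f : X → ℝ)
    (R : ℕ → X → X → Prop) (hR : ∀ m m' x y, m ≤ m' → R m' x y → R m x y)
    (N : ℕ) (U : ℕ → ℕ → X → ℝ) (t : ℕ → ℝ) (hw : ∀ x, 0 ≤ w x)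
    (hf : ∀ x, 0 ≤ f x)
    (hUmono : ∀ a r x, U a r x ≤ U a (r + 1) x)
    (hUlevel : ∀ a r, LevelMeasurable R r (U a r))
    (hUbound : ∀ a i x, a ≤ i → i ≤ N → U a N x - U a i x ≤ t (i - a))
    (J : Finset ℕ) (hJ : ∀ j ∈ J, j < N) (C g : ℝ) (hC0 : 0 ≤ C) (hg0 : 0 ≤ g)
    (hC : ∀ j, ∑ i ∈ J with j ≤ i, renewal t (i - j) ≤ C)
    (hg : ∀ j ∈ J, ∀ φ : X → ℝ, (∀ x, 0 ≤ φ x) → LevelMeasurable R j φ →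
      g * ∑ x, φ x * (w x * ∏ a ∈ Finset.Ioc j N, Real.exp (U a N x)) ≤
        ∑ x, φ x * (f x * w x * ∏ a ∈ Finset.Ioc j N, Real.exp (U a N x))) :
    g * (∑ i ∈ J, renewal t i) *
        ∑ x, w x * ∏ a ∈ Finset.Ioc 0 N, Real.exp (U a N x) ≤
      C * ∑ x, f x * w x * ∏ a ∈ Finset.Ioc 0 N, Real.exp (U a N x) := by
  simpa using renewal_bound_aux w f R hR N U t hw hf hUmono hUlevel hUbound J hJ C g hC0 hg0
    hC hg 0 (Nat.zero_le _) 0 le_rfl (Nat.zero_le _) (fun _ => 1) (fun _ => zero_le_one)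
    (fun _ _ _ => rfl)

end Renewal

section Resampling

lemma ov_of_mem {S : Type} (x : Conf S) {Λ : Finset ℤ} (ζ : Λ → S) {i : ℤ} (h : i ∈ Λ) :
    ov x Λ ζ i = ζ ⟨i, h⟩ := dif_pos h

lemma ov_of_notMem {S : Type} (x : Conf S) {Λ : Finset ℤ} (ζ : Λ → S) {i : ℤ} (h : i ∉ Λ) :
    ov x Λ ζ i = x i := dif_neg h

/-- The sum of `F` over all configurations which agree with `x` off `V`. -/
def fiberSum {S : Type} [Fintype S] (V : Finset ℤ) (F : Conf S → ℝ) (x : Conf S) : ℝ :=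
  ∑ ζ : V → S, F (ov x V ζ)

lemma ov_congr {S : Type} {V : Finset ℤ} {x y : Conf S} (h : ∀ i ∉ V, x i = y i) (ζ : V → S) :
    ov x V ζ = ov y V ζ := by
  funext i
  by_cases hi : i ∈ V
  · rw [ov_of_mem _ _ hi, ov_of_mem _ _ hi]
  · rw [ov_of_notMem _ _ hi, ov_of_notMem _ _ hi, h i hi]

lemma fiberSum_congr {S : Type} [Fintype S] {V : Finset ℤ} (F : Conf S → ℝ) {x y : Conf S}
    (h : ∀ i ∉ V, x i = y i) : fiberSum V F x = fiberSum V F y :=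
  Finset.sum_congr rfl fun ζ _ => by rw [ov_congr h]

lemma fiberSum_mono {S : Type} [Fintype S] {V : Finset ℤ} {F G : Conf S → ℝ} {x : Conf S}
    (h : ∀ y, (∀ i ∉ V, y i = x i) → F y ≤ G y) : fiberSum V F x ≤ fiberSum V G x :=
  Finset.sum_le_sum fun _ _ => h _ fun _ hi => ov_of_notMem _ _ hi

lemma fiberSum_eq {S : Type} [Fintype S] {V : Finset ℤ} {F G : Conf S → ℝ} {x : Conf S}
    (h : ∀ y, (∀ i ∉ V, y i = x i) → F y = G y) : fiberSum V F x = fiberSum V G x :=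
  Finset.sum_congr rfl fun _ _ => h _ fun _ hi => ov_of_notMem _ _ hi

lemma fiberSum_nonneg {S : Type} [Fintype S] {V : Finset ℤ} {F : Conf S → ℝ} (h : ∀ y, 0 ≤ F y)
    (x : Conf S) : 0 ≤ fiberSum V F x := Finset.sum_nonneg fun _ _ => h _

lemma fiberSum_pos {S : Type} [Fintype S] [Nonempty S] {V : Finset ℤ} {F : Conf S → ℝ}
    (h : ∀ y, 0 < F y) (x : Conf S) : 0 < fiberSum V F x :=
  Finset.sum_pos (fun _ _ => h _) Finset.univ_nonempty

lemma fiberSum_const_mul {S : Type} [Fintype S] (V : Finset ℤ) (c : ℝ) (F : Conf S → ℝ)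
    (x : Conf S) : fiberSum V (fun y => c * F y) x = c * fiberSum V F x :=
  (Finset.mul_sum _ _ _).symm

/-- A factor which does not depend on `V` can be pulled out of a sum over the fiber. -/
lemma fiberSum_mul_left {S : Type} [Fintype S] {V : Finset ℤ} {G : Conf S → ℝ}
    (hG : ∀ x y : Conf S, (∀ i ∉ V, x i = y i) → G x = G y) (F : Conf S → ℝ) (x : Conf S) :
    fiberSum V (fun y => G y * F y) x = G x * fiberSum V F x := by
  rw [← fiberSum_const_mul]
  exact fiberSum_eq fun y hy => by rw [hG y x hy]

lemma ov_ov_involutive {S : Type} {V V' : Finset ℤ} (h : V' ⊆ V) :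
    Function.Involutive fun p : (V → S) × (V' → S) =>
      ((fun i => if hi : (i : ℤ) ∈ V' then p.2 ⟨i, hi⟩ else p.1 i : V → S),
        (fun i => p.1 ⟨i, h i.2⟩ : V' → S)) := by
  rintro ⟨ζ, ξ⟩
  refine Prod.ext (funext fun i => ?_) (funext fun i => ?_)
  · by_cases hi : (i : ℤ) ∈ V' <;> simp [hi]
  · simp

/-- Resampling a configuration of `V` inside a smaller set. -/
lemma fiberSum_fiberSum {S : Type} [Fintype S] {V V' : Finset ℤ} (h : V' ⊆ V)
    (F : Conf S → ℝ) (x : Conf S) :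
    fiberSum V (fiberSum V' F) x = Fintype.card (V' → S) * fiberSum V F x := by
  have h1 : fiberSum V (fiberSum V' F) x =
      ∑ p : (V → S) × (V' → S), F (ov (ov x V p.1) V' p.2) := by
    rw [Fintype.sum_prod_type]; rfl
  have h2 : Fintype.card (V' → S) * fiberSum V F x =
      ∑ p : (V → S) × (V' → S), F (ov x V p.1) := by
    rw [Fintype.sum_prod_type]
    simp [fiberSum, Finset.mul_sum]
  rw [h1, h2]
  refine Fintype.sum_equiv (ov_ov_involutive h).toPerm _ _ fun p => congrArg F ?_
  funext i
  by_cases hi' : i ∈ V'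
  · rw [ov_of_mem _ _ hi', ov_of_mem _ _ (h hi')]
    simp [hi']
  · rw [ov_of_notMem _ _ hi']
    by_cases hi : i ∈ V
    · rw [ov_of_mem _ _ hi, ov_of_mem _ _ hi]
      simp [hi']
    · rw [ov_of_notMem _ _ hi, ov_of_notMem _ _ hi]

/-- The renewal lower bound for a Gibbsian weight on a nested sequence of regions. -/
lemma renewal_bound_fiberSum {S : Type} [Fintype S] [Nonempty S] {A : ℕ → Finset ℤ}
    (hA : Antitone A) (N : ℕ) (t : ℕ → ℝ) {ι : Type} [DecidableEq ι] (E : Finset ι) (lo hi : ι → ℕ)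
    (ψ : ι → Conf S → ℝ) (v : ι → ℝ) (hψ0 : ∀ e ∈ E, ∀ x, 0 ≤ ψ e x)
    (hψv : ∀ e ∈ E, ∀ x, ψ e x ≤ v e)
    (hψ : ∀ e ∈ E, ∀ x y, (∀ i ∉ A (hi e), x i = y i) → ψ e x = ψ e y)
    (hlo : ∀ e ∈ E, 1 ≤ lo e ∧ lo e ≤ N) (hhi : ∀ e ∈ E, hi e ≤ N)
    (hv : ∀ a i, a ≤ i → ∑ e ∈ E with lo e = a ∧ i < hi e, v e ≤ t (i - a))
    (w f : Conf S → ℝ) (hw : ∀ x, 0 ≤ w x) (hf : ∀ x, 0 ≤ f x)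
    (J : Finset ℕ) (hJ : ∀ j ∈ J, j < N) (C g : ℝ) (hC0 : 0 ≤ C) (hg0 : 0 ≤ g)
    (hC : ∀ j, ∑ i ∈ J with j ≤ i, renewal t (i - j) ≤ C)
    (hg : ∀ j ∈ J, ∀ x,
      g * fiberSum (A j) (fun y => w y * Real.exp (∑ e ∈ E with j < lo e, ψ e y)) x ≤
        fiberSum (A j) (fun y => f y * w y * Real.exp (∑ e ∈ E with j < lo e, ψ e y)) x)
    (x : Conf S) :
    g * (∑ i ∈ J, renewal t i) *
        fiberSum (A 0) (fun y => w y * Real.exp (∑ e ∈ E, ψ e y)) x ≤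
      C * fiberSum (A 0) (fun y => f y * w y * Real.exp (∑ e ∈ E, ψ e y)) x := by
  set U : ℕ → ℕ → Conf S → ℝ := fun a r y => ∑ e ∈ E with lo e = a ∧ hi e ≤ r, ψ e y with hU
  have hprod : ∀ j y, ∏ a ∈ Finset.Ioc j N, Real.exp (U a N y) =
      Real.exp (∑ e ∈ E with j < lo e, ψ e y) := by
    intro j y
    rw [← Real.exp_sum]
    congr 1
    have h1 : ∀ e ∈ E.filter (fun e => j < lo e), lo e ∈ Finset.Ioc j N := fun e he =>
      Finset.mem_Ioc.2 ⟨(Finset.mem_filter.1 he).2, (hlo e (Finset.mem_filter.1 he).1).2⟩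
    rw [← Finset.sum_fiberwise_of_maps_to h1]
    refine Finset.sum_congr rfl fun a ha => ?_
    rw [hU, Finset.filter_filter]
    refine Finset.sum_congr (Finset.filter_congr fun e he => ?_) fun _ _ => rfl
    have := (Finset.mem_Ioc.1 ha).1
    have := hhi e he
    omega
  have hall : ∀ y, ∑ e ∈ E with 0 < lo e, ψ e y = ∑ e ∈ E, ψ e y := fun y => by
    rw [Finset.filter_true_of_mem fun e he => Nat.lt_of_succ_le (hlo e he).1]
  let R : ℕ → (A 0 → S) → (A 0 → S) → Prop := fun m ζ ξ =>
    ∀ i ∉ A m, ov x (A 0) ζ i = ov x (A 0) ξ i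
  have main := renewal_bound (X := A 0 → S) (fun ζ => w (ov x (A 0) ζ))
    (fun ζ => f (ov x (A 0) ζ)) R
    (fun m m' ζ ξ hm h i hi => h i fun h' => hi (hA hm h')) N
    (fun a r ζ => U a r (ov x (A 0) ζ)) t (fun _ => hw _) (fun _ => hf _)
    (fun a r ζ => Finset.sum_le_sum_of_subset_of_nonneg
      (Finset.monotone_filter_right _ fun e _ h => ⟨h.1, by omega⟩)
      fun e he _ => hψ0 e (Finset.mem_filter.1 he).1 _)
    (fun a r ζ ξ h => Finset.sum_congr rfl fun e he => by
      obtain ⟨he, -, hr⟩ := Finset.mem_filter.1 he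
      exact hψ e he _ _ fun i hi => h i fun h' => hi (hA hr h'))
    (fun a i ζ hai hiN => by
      refine le_trans ?_ (hv a i hai)
      have hsub : E.filter (fun e => lo e = a ∧ hi e ≤ i) ⊆
          E.filter (fun e => lo e = a ∧ hi e ≤ N) :=
        Finset.monotone_filter_right _ fun e _ h => ⟨h.1, h.2.trans hiN⟩
      rw [hU]
      simp only []
      rw [← Finset.sum_sdiff hsub, add_sub_cancel_right]
      have heq : E.filter (fun e => lo e = a ∧ hi e ≤ N) \
          E.filter (fun e => lo e = a ∧ hi e ≤ i) ⊆
          E.filter (fun e => lo e = a ∧ i < hi e) := by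
        intro e he
        simp only [Finset.mem_sdiff, Finset.mem_filter, not_and, not_le] at he ⊢
        exact ⟨he.1.1, he.1.2.1, he.2 he.1.1 he.1.2.1⟩
      refine (Finset.sum_le_sum fun e he => hψv e
        (Finset.mem_filter.1 (heq he)).1 _).trans ?_
      exact Finset.sum_le_sum_of_subset_of_nonneg heq fun e he _ =>
        (hψ0 e (Finset.mem_filter.1 he).1 x).trans (hψv e (Finset.mem_filter.1 he).1 x))
    J hJ C g hC0 hg0 hC ?_
  · simp only [hprod, hall] at main
    exact main
  · intro j hj φ hφ hφl
    simp only [hprod]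
    let φ' : Conf S → ℝ := fun y => φ fun i => y i
    have hφ' : ∀ ζ, φ' (ov x (A 0) ζ) = φ ζ := fun ζ => by
      simp only [φ']
      congr 1
      funext i
      rw [ov_of_mem _ _ i.2]
    have hsplit : ∀ F : Conf S → ℝ, (Fintype.card (A j → S) : ℝ) *
        ∑ ζ : A 0 → S, φ ζ * F (ov x (A 0) ζ) =
          ∑ ζ : A 0 → S, φ ζ * fiberSum (A j) F (ov x (A 0) ζ) := by
      intro F
      have h0 : ∑ ζ : A 0 → S, φ ζ * F (ov x (A 0) ζ) =
          fiberSum (A 0) (fun y => φ' y * F y) x :=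
        Finset.sum_congr rfl fun ζ _ => by simp only [hφ']
      rw [h0, ← fiberSum_fiberSum (hA (Nat.zero_le j))]
      refine Finset.sum_congr rfl fun ζ _ => ?_
      rw [fiberSum, fiberSum, Finset.mul_sum]
      refine Finset.sum_congr rfl fun ξ _ => ?_
      rw [← hφ' ζ]
      congr 1
      refine hφl _ _ fun i hi => ?_
      by_cases h0 : i ∈ A 0
      · rw [ov_of_mem _ _ h0, ov_of_mem _ _ h0, ov_of_notMem _ _ hi]
      · rw [ov_of_notMem _ _ h0, ov_of_notMem _ _ h0]
    have hcard : (0 : ℝ) < Fintype.card (A j → S) := by exact_mod_cast Fintype.card_pos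
    refine le_of_mul_le_mul_left ?_ hcard
    rw [mul_left_comm, hsplit fun y => w y * Real.exp (∑ e ∈ E with j < lo e, ψ e y),
      hsplit fun y => f y * w y * Real.exp (∑ e ∈ E with j < lo e, ψ e y), Finset.mul_sum]
    refine Finset.sum_le_sum fun ζ _ => ?_
    rw [mul_left_comm]
    exact mul_le_mul_of_nonneg_left (hg j hj _) (hφ ζ)

end Resampling

section Extremes

/-- The smallest element of `K` (`0` if `K` is empty). -/
def lowest (K : Finset ℤ) : ℤ := if h : K.Nonempty then K.min' h else 0

/-- The largest element of `K` (`0` if `K` is empty). -/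
def highest (K : Finset ℤ) : ℤ := if h : K.Nonempty then K.max' h else 0

lemma lowest_mem {K : Finset ℤ} (h : K.Nonempty) : lowest K ∈ K := by
  rw [lowest, dif_pos h]; exact K.min'_mem h

lemma highest_mem {K : Finset ℤ} (h : K.Nonempty) : highest K ∈ K := by
  rw [highest, dif_pos h]; exact K.max'_mem h

lemma lowest_le {K : Finset ℤ} {i : ℤ} (h : i ∈ K) : lowest K ≤ i := by
  rw [lowest, dif_pos ⟨i, h⟩]; exact K.min'_le i h

lemma le_highest {K : Finset ℤ} {i : ℤ} (h : i ∈ K) : i ≤ highest K := by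
  rw [highest, dif_pos ⟨i, h⟩]; exact K.le_max' i h

lemma subset_Ioc_iff {K : Finset ℤ} (h : K.Nonempty) {a b : ℤ} :
    K ⊆ Finset.Ioc a b ↔ a < lowest K ∧ highest K ≤ b := by
  constructor
  · intro hK
    exact ⟨(Finset.mem_Ioc.1 (hK (lowest_mem h))).1, (Finset.mem_Ioc.1 (hK (highest_mem h))).2⟩
  · rintro ⟨h1, h2⟩ i hi
    exact Finset.mem_Ioc.2 ⟨h1.trans_le (lowest_le hi), (le_highest hi).trans h2⟩

lemma mem_translate {n i : ℤ} {K : Finset ℤ} :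
    i ∈ K.image (fun j => n + j) ↔ i - n ∈ K := by
  rw [Finset.mem_image]
  constructor
  · rintro ⟨j, hj, rfl⟩
    rwa [add_sub_cancel_left]
  · intro h
    exact ⟨i - n, h, by ring⟩

lemma translate_injective (n : ℤ) :
    Function.Injective fun K : Finset ℤ => K.image fun j => n + j :=
  Finset.image_injective (add_right_injective n)

lemma highest_translate {K : Finset ℤ} (h : K.Nonempty) (n : ℤ) :
    highest (K.image fun j => n + j) = n + highest K := by
  refine le_antisymm ?_ (le_highest (mem_translate.2 (by simpa using highest_mem h)))
  have := le_highest (mem_translate.1 (highest_mem (h.image fun j => n + j)))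
  linarith

end Extremes

section Potentials

variable {S : Type} [Fintype S] [MeasurableSpace S] (P : Potential S)

lemma eq_of_measurable_cylSA {S : Type} [MeasurableSpace S] {Λ : Set ℤ} {h : Conf S → ℝ}
    (hh : Measurable[cylSA Λ] h) {x y : Conf S} (hxy : ∀ i ∈ Λ, x i = y i) : h x = h y := by
  obtain ⟨B, -, hB⟩ := hh (measurableSet_singleton (h x))
  have hx : x ∈ h ⁻¹' {h x} := rfl
  rw [← hB] at hx
  have hy : y ∈ (fun x => Λ.domRestrict x) ⁻¹' B := by
    have : Λ.domRestrict y = Λ.domRestrict x := funext fun i => (hxy i i.2).symm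
    rw [Set.mem_preimage, this]
    exact hx
  have : y ∈ h ⁻¹' {h x} := hB ▸ hy
  exact this.symm

lemma Potential.congr {K : Finset ℤ} (hK : K.Nonempty) {x y : Conf S}
    (h : ∀ i ∈ K, x i = y i) : P.Φ K x = P.Φ K y :=
  eq_of_measurable_cylSA (P.measurable K hK) h

lemma Potential.bddAbove (K : Finset ℤ) : BddAbove (Set.range (P.Φ K)) := by
  obtain ⟨C, hC⟩ := P.bounded K
  exact ⟨C, by rintro _ ⟨x, rfl⟩; exact (abs_le.1 (hC x)).2⟩

lemma Potential.bddBelow (K : Finset ℤ) : BddBelow (Set.range (P.Φ K)) := by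
  obtain ⟨C, hC⟩ := P.bounded K
  exact ⟨-C, by rintro _ ⟨x, rfl⟩; exact (abs_le.1 (hC x)).1⟩

lemma Potential.abs_le_pnorm (K : Finset ℤ) (x : Conf S) : |P.Φ K x| ≤ pnorm (P.Φ K) := by
  obtain ⟨C, hC⟩ := P.bounded K
  exact le_ciSup (f := fun x => |P.Φ K x|) ⟨C, by rintro _ ⟨x, rfl⟩; exact hC x⟩ x

/-- The nonnegative function `sup Φ_K - Φ_K`. -/
def defect (K : Finset ℤ) (x : Conf S) : ℝ := (⨆ y, P.Φ K y) - P.Φ K x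

lemma defect_nonneg (K : Finset ℤ) (x : Conf S) : 0 ≤ defect P K x :=
  sub_nonneg.2 (le_ciSup (P.bddAbove K) x)

lemma defect_le_pvar (K : Finset ℤ) (x : Conf S) : defect P K x ≤ pvar (P.Φ K) :=
  sub_le_sub_left (ciInf_le (P.bddBelow K) x) _

lemma defect_congr {K : Finset ℤ} (hK : K.Nonempty) {x y : Conf S}
    (h : ∀ i ∈ K, x i = y i) : defect P K x = defect P K y := by
  rw [defect, defect, P.congr hK h]

lemma pvar_nonneg [Nonempty S] (K : Finset ℤ) : 0 ≤ pvar (P.Φ K) :=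
  (defect_nonneg P K (Classical.arbitrary _)).trans (defect_le_pvar P K _)

lemma pvar_le_two_mul_pnorm [Nonempty S] (K : Finset ℤ) :
    pvar (P.Φ K) ≤ 2 * pnorm (P.Φ K) := by
  have h1 : (⨆ x, P.Φ K x) ≤ pnorm (P.Φ K) :=
    ciSup_le fun x => (abs_le.1 (P.abs_le_pnorm K x)).2
  have h2 : -pnorm (P.Φ K) ≤ ⨅ x, P.Φ K x :=
    le_ciInf fun x => (abs_le.1 (P.abs_le_pnorm K x)).1
  rw [pvar]
  linarith

lemma shift_surjective {S : Type} (n : ℤ) : Function.Surjective (shift (S := S) n) :=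
  fun x => ⟨shift (-n) x, by funext i; simp [shift]⟩

lemma pvar_translate {K : Finset ℤ} (hK : K.Nonempty) (n : ℤ) :
    pvar (P.Φ (K.image fun j => n + j)) = pvar (P.Φ K) := by
  have : P.Φ (K.image fun j => n + j) = fun x => P.Φ K (shift n x) :=
    funext fun x => P.invariant n K hK x
  rw [this, pvar, pvar, (shift_surjective n).iSup_comp (P.Φ K),
    (shift_surjective n).iInf_comp (P.Φ K)]

lemma pnorm_translate {K : Finset ℤ} (hK : K.Nonempty) (n : ℤ) :
    pnorm (P.Φ (K.image fun j => n + j)) = pnorm (P.Φ K) := by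
  have : P.Φ (K.image fun j => n + j) = fun x => P.Φ K (shift n x) :=
    funext fun x => P.invariant n K hK x
  rw [this, pnorm, pnorm, (shift_surjective n).iSup_comp fun x => |P.Φ K x|]

variable {P}

lemma summable_varTail [Nonempty S] (hP : NormSummable P) (n : ℕ) :
    Summable fun Λ : {Λ : Finset ℤ // (0 : ℤ) ∈ Λ ∧ ∃ i ∈ Λ, (n : ℤ) ≤ i} =>
      pvar (P.Φ ↑Λ) := by
  have h1 : Summable fun Λ : {Λ : Finset ℤ // (0 : ℤ) ∈ Λ ∧ ∃ i ∈ Λ, (n : ℤ) ≤ i} =>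
      2 * pnorm (P.Φ ↑Λ) := by
    refine Summable.mul_left 2 ?_
    exact hP.comp_injective (i := fun Λ : {Λ : Finset ℤ // (0 : ℤ) ∈ Λ ∧ ∃ i ∈ Λ, (n : ℤ) ≤ i} =>
      (⟨Λ, Λ.2.1⟩ : {Λ : Finset ℤ // (0 : ℤ) ∈ Λ})) fun a b h => Subtype.ext (congrArg
        (fun Λ : {Λ : Finset ℤ // (0 : ℤ) ∈ Λ} => (Λ : Finset ℤ)) h)
  exact Summable.of_nonneg_of_le (fun Λ => pvar_nonneg P _) (fun Λ => pvar_le_two_mul_pnorm P _) h1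

lemma varTail_nonneg [Nonempty S] (n : ℕ) : 0 ≤ varTail P n :=
  tsum_nonneg fun _ => pvar_nonneg P _

/-- The total variation of a finite family of sets, which can be translated injectively
into the index set of `varTail P n`. -/
lemma sum_pvar_le_varTail [Nonempty S] (hP : NormSummable P) (n : ℕ) (F : Finset (Finset ℤ))
    (τ : Finset ℤ → ℤ) (h0 : ∀ K ∈ F, -τ K ∈ K) (hn : ∀ K ∈ F, ∃ i ∈ K, (n : ℤ) ≤ τ K + i)
    (hinj : Set.InjOn (fun K : Finset ℤ => K.image fun j => τ K + j) F) :
    ∑ K ∈ F, pvar (P.Φ K) ≤ varTail P n := by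
  let e : F → {Λ : Finset ℤ // (0 : ℤ) ∈ Λ ∧ ∃ i ∈ Λ, (n : ℤ) ≤ i} := fun K =>
    ⟨(K : Finset ℤ).image fun j => τ K + j, mem_translate.2 (by simpa using h0 K K.2), by
      obtain ⟨i, hi, hni⟩ := hn K K.2
      exact ⟨_, Finset.mem_image_of_mem _ hi, hni⟩⟩
  have he : Function.Injective e := fun K L h =>
    Subtype.ext (hinj K.2 L.2 (congrArg Subtype.val h))
  have h1 : ∑ K ∈ F, pvar (P.Φ K) = ∑ K : F, pvar (P.Φ (e K : Finset ℤ)) := by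
    rw [← Finset.sum_coe_sort F]
    exact Finset.sum_congr rfl fun K _ => (pvar_translate P ⟨_, h0 K K.2⟩ _).symm
  rw [h1]
  refine (Finset.sum_map Finset.univ ⟨e, he⟩
    fun Λ => pvar (P.Φ (Λ : Finset ℤ))).symm.trans_le ?_
  exact (summable_varTail hP n).sum_le_tsum _ fun _ _ => pvar_nonneg P _

lemma sum_pvar_le_of_mem [Nonempty S] (hP : NormSummable P) (n : ℕ) (F : Finset (Finset ℤ))
    (a : ℤ) (ha : ∀ K ∈ F, a ∈ K) (hn : ∀ K ∈ F, ∃ i ∈ K, a + n ≤ i) :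
    ∑ K ∈ F, pvar (P.Φ K) ≤ varTail P n := by
  refine sum_pvar_le_varTail hP n F (fun _ => -a) (by simpa using ha) (fun K hK => ?_)
    (translate_injective _).injOn
  obtain ⟨i, hi, h⟩ := hn K hK
  exact ⟨i, hi, by linarith⟩

lemma sum_pvar_le_of_highest [Nonempty S] (hP : NormSummable P) (n : ℕ)
    (F : Finset (Finset ℤ)) (b : ℤ) (hne : ∀ K ∈ F, K.Nonempty) (hb : ∀ K ∈ F, highest K = b)
    (hn : ∀ K ∈ F, lowest K + n ≤ b) :
    ∑ K ∈ F, pvar (P.Φ K) ≤ varTail P n := by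
  refine sum_pvar_le_varTail hP n F (fun K => -lowest K)
    (fun K hK => by simpa using lowest_mem (hne K hK))
    (fun K hK => ⟨highest K, highest_mem (hne K hK), ?_⟩) (fun K hK L hL h => ?_)
  · have := hn K hK
    rw [hb K hK]
    linarith
  · have h1 := congrArg highest h
    simp only [highest_translate (hne K hK), highest_translate (hne L hL), hb K hK,
      hb L hL] at h1
    have h2 : lowest K = lowest L := by linarith
    simp only [h2] at h
    exact translate_injective _ h

lemma varTail_antitone [Nonempty S] (hP : NormSummable P) : Antitone (varTail P) := by
  intro m n hmn
  refine (summable_varTail hP n).tsum_le_of_sum_le fun s => ?_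
  have := sum_pvar_le_of_mem hP m (s.map (Function.Embedding.subtype _)) 0 ?_ ?_
  · rwa [Finset.sum_map] at this
  · intro K hK
    obtain ⟨L, -, rfl⟩ := Finset.mem_map.1 hK
    exact L.2.1
  · intro K hK
    obtain ⟨L, -, rfl⟩ := Finset.mem_map.1 hK
    obtain ⟨i, hi, h⟩ := L.2.2
    exact ⟨i, hi, by rw [zero_add]; exact (by exact_mod_cast hmn : (m : ℤ) ≤ n).trans h⟩

end Potentials

section Core

variable {S : Type} [Fintype S] [Nonempty S] [MeasurableSpace S] {P : Potential S}

/-- The Boltzmann weight, up to normalization, of the interactions in `𝓕`. -/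
def weight (P : Potential S) (𝓕 : Finset (Finset ℤ)) (x : Conf S) : ℝ :=
  Real.exp (∑ K ∈ 𝓕, defect P K x)

/-- The members of `𝓚` contained in the interval `(a, b]`. -/
def inside (𝓚 : Finset (Finset ℤ)) (a b : ℤ) : Finset (Finset ℤ) :=
  𝓚.filter fun K => K ⊆ Finset.Ioc a b

omit [Nonempty S] in
lemma weight_pos (𝓕 : Finset (Finset ℤ)) (x : Conf S) : 0 < weight P 𝓕 x := Real.exp_pos _

omit [Nonempty S] in
lemma weight_congr {𝓕 : Finset (Finset ℤ)} (hne : ∀ K ∈ 𝓕, K.Nonempty) {x y : Conf S}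
    (h : ∀ K ∈ 𝓕, ∀ i ∈ K, x i = y i) : weight P 𝓕 x = weight P 𝓕 y := by
  rw [weight, weight, Finset.sum_congr rfl fun K hK => defect_congr P (hne K hK) (h K hK)]

omit [Nonempty S] in
lemma weight_union {𝓕 𝓖 : Finset (Finset ℤ)} (h : Disjoint 𝓕 𝓖) (x : Conf S) :
    weight P (𝓕 ∪ 𝓖) x = weight P 𝓕 x * weight P 𝓖 x := by
  rw [weight, weight, weight, ← Real.exp_add, Finset.sum_union h]

omit [Nonempty S] in
lemma one_le_weight (𝓕 : Finset (Finset ℤ)) (x : Conf S) : 1 ≤ weight P 𝓕 x :=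
  Real.one_le_exp (Finset.sum_nonneg fun _ _ => defect_nonneg P _ _)

omit [Nonempty S] in
lemma weight_le {𝓕 : Finset (Finset ℤ)} {C : ℝ} (h : ∑ K ∈ 𝓕, pvar (P.Φ K) ≤ C) (x : Conf S) :
    weight P 𝓕 x ≤ Real.exp C :=
  Real.exp_le_exp.2 ((Finset.sum_le_sum fun K _ => defect_le_pvar P K x).trans h)

lemma sum_renewal_shift_le {t : ℕ → ℝ} (ht : ∀ d, 0 ≤ t d) {l : ℕ} {J : Finset ℕ}
    (hJ : J ⊆ Finset.Icc l (2 * l)) (j : ℕ) :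
    ∑ i ∈ J with j ≤ i, renewal t (i - j) ≤ ∑ n ∈ Finset.range (l + 1), renewal t n := by
  have h1 : ∑ i ∈ J with j ≤ i, renewal t (i - j) ≤
      ∑ i ∈ J with j ≤ i, renewal t (i - max j l) :=
    Finset.sum_le_sum fun i _ => renewal_antitone ht (by omega)
  refine h1.trans ?_
  have hinj : Set.InjOn (fun i => i - max j l) (J.filter fun i => j ≤ i) := by
    intro a ha b hb hab
    simp only [Finset.coe_filter, Set.mem_ofPred_eq] at ha hb
    have ha' := Finset.mem_Icc.1 (hJ ha.1)
    have hb' := Finset.mem_Icc.1 (hJ hb.1)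
    simp only at hab
    omega
  rw [← Finset.sum_image (f := renewal t) hinj]
  refine Finset.sum_le_sum_of_subset_of_nonneg (fun n hn => ?_) fun _ _ _ => (renewal_pos t _).le
  obtain ⟨i, hi, rfl⟩ := Finset.mem_image.1 hn
  have := Finset.mem_Icc.1 (hJ (Finset.mem_filter.1 hi).1)
  rw [Finset.mem_range]
  omega

variable {t : ℕ → ℝ} {𝓚 : Finset (Finset ℤ)} {c : ℤ} {l N : ℕ} {C g : ℝ}

/-- Cutting the interval `(c + j, c + N]` at a renewal point on the right. -/
lemma right_cut (hP : NormSummable P) (ht : ∀ d, t d = varTail P (d + 1))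
    (hne : ∀ K ∈ 𝓚, K.Nonempty) (hN : 4 * l < N) {j : ℕ} (f w : Conf S → ℝ)
    (hf : ∀ x, 0 ≤ f x) (hw0 : ∀ x, 0 ≤ w x)
    (hw : ∀ x y, (∀ i ∉ Finset.Ioc (c + j) (c + N - l), x i = y i) → w x = w y)
    (J : Finset ℕ) (hJ : J ⊆ Finset.Icc l (2 * l)) (hg0 : 0 ≤ g)
    (hC : C = ∑ n ∈ Finset.range (l + 1), renewal t n)
    (hg : ∀ k ∈ J, ∀ x,
      g * fiberSum (Finset.Ioc (c + j) (c + N - k))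
          (weight P (inside 𝓚 (c + j) (c + N - k))) x ≤
        fiberSum (Finset.Ioc (c + j) (c + N - k))
          (fun y => f y * weight P (inside 𝓚 (c + j) (c + N - k)) y) x)
    (x : Conf S) :
    g * (∑ k ∈ J, renewal t k) * fiberSum (Finset.Ioc (c + j) (c + N))
        (fun y => w y * weight P (inside 𝓚 (c + j) (c + N)) y) x ≤
      C * fiberSum (Finset.Ioc (c + j) (c + N))
        (fun y => f y * w y * weight P (inside 𝓚 (c + j) (c + N)) y) x := by
  have ht0 : ∀ d, 0 ≤ t d := fun d => by rw [ht]; exact varTail_nonneg _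
  have hE : ∀ K ∈ inside 𝓚 (c + j) (c + N), K ∈ 𝓚 ∧ K.Nonempty ∧
      c + j < lowest K ∧ highest K ≤ c + N ∧ lowest K ≤ highest K := fun K hK => by
    obtain ⟨h1, h2⟩ := Finset.mem_filter.1 hK
    have h3 := hne K h1
    exact ⟨h1, h3, ((subset_Ioc_iff h3).1 h2).1, ((subset_Ioc_iff h3).1 h2).2,
      lowest_le (highest_mem h3)⟩
  have hfilter : ∀ k : ℕ, (inside 𝓚 (c + j) (c + N)).filter
      (fun K => k < (c + N + 1 - highest K).toNat) = inside 𝓚 (c + j) (c + N - k) := by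
    intro k
    ext K
    by_cases hK : K ∈ 𝓚
    · simp only [inside, Finset.mem_filter, hK, true_and, subset_Ioc_iff (hne K hK)]
      omega
    · simp [inside, hK]
  have main := renewal_bound_fiberSum (S := S)
    (A := fun k : ℕ => Finset.Ioc (c + j) (c + N - k))
    (fun a b hab => Finset.Ioc_subset_Ioc_right (by omega)) N t
    (inside 𝓚 (c + j) (c + N)) (fun K => (c + N + 1 - highest K).toNat)
    (fun K => (c + N + 1 - lowest K).toNat) (defect P) (fun K => pvar (P.Φ K))
    (fun _ _ => defect_nonneg P _) (fun _ _ => defect_le_pvar P _) ?_ ?_ ?_ ?_ w f hw0 hf J ?_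
    C g ?_ hg0 ?_ ?_ x
  · simp only [Nat.cast_zero, sub_zero] at main
    exact main
  · intro K hK x y hxy
    obtain ⟨-, h1, h2, h3, h4⟩ := hE K hK
    refine defect_congr P h1 fun i hi => hxy i ?_
    have := lowest_le hi
    rw [Finset.mem_Ioc]
    omega
  · intro K hK
    have := hE K hK
    omega
  · intro K hK
    have := hE K hK
    omega
  · intro a i hai
    rw [ht]
    refine sum_pvar_le_of_highest hP _ _ (c + N + 1 - a) (fun K hK => ?_) (fun K hK => ?_)
      fun K hK => ?_
    · exact (hE K (Finset.mem_filter.1 hK).1).2.1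
    · obtain ⟨h1, h2, h3⟩ := Finset.mem_filter.1 hK
      have := hE K h1
      omega
    · obtain ⟨h1, h2, h3⟩ := Finset.mem_filter.1 hK
      have := hE K h1
      push_cast [hai]
      omega
  · intro k hk
    have := Finset.mem_Icc.1 (hJ hk)
    omega
  · rw [hC]
    exact Finset.sum_nonneg fun _ _ => (renewal_pos t _).le
  · rw [hC]
    exact sum_renewal_shift_le ht0 hJ
  · intro k hk y
    have hk' := Finset.mem_Icc.1 (hJ hk)
    have hw' : ∀ x y : Conf S, (∀ i ∉ Finset.Ioc (c + j) (c + N - k), x i = y i) → w x = w y :=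
      fun x y h => hw x y fun i hi => h i fun hi' =>
        hi (Finset.Ioc_subset_Ioc_right (by omega) hi')
    have h := hg k hk y
    have e1 := fiberSum_mul_left hw' (weight P (inside 𝓚 (c + j) (c + N - k))) y
    have e2 := fiberSum_mul_left hw'
      (fun y => f y * weight P (inside 𝓚 (c + j) (c + N - k)) y) y
    simp only [hfilter]
    have e3 : (fun y => f y * w y * weight P (inside 𝓚 (c + j) (c + N - k)) y) =
        fun y => w y * (f y * weight P (inside 𝓚 (c + j) (c + N - k)) y) := by
      funext y; ring
    change g * fiberSum _ (fun y => w y * weight P (inside 𝓚 (c + j) (c + N - k)) y) y ≤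
      fiberSum _ (fun y => f y * w y * weight P (inside 𝓚 (c + j) (c + N - k)) y) y
    rw [e3, e1, e2, mul_left_comm]
    exact mul_le_mul_of_nonneg_left h (hw0 y)

/-- Cutting the interval `(c, c + N]` at a renewal point on the left. -/
lemma left_cut (hP : NormSummable P) (ht : ∀ d, t d = varTail P (d + 1))
    (hne : ∀ K ∈ 𝓚, K.Nonempty) (hN : 4 * l < N) (f w : Conf S → ℝ)
    (hf : ∀ x, 0 ≤ f x) (hw0 : ∀ x, 0 ≤ w x)
    (J : Finset ℕ) (hJ : J ⊆ Finset.Icc l (2 * l)) (hg0 : 0 ≤ g)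
    (hC : C = ∑ n ∈ Finset.range (l + 1), renewal t n)
    (hg : ∀ j ∈ J, ∀ x,
      g * fiberSum (Finset.Ioc (c + j) (c + N))
          (fun y => w y * weight P (inside 𝓚 (c + j) (c + N)) y) x ≤
        fiberSum (Finset.Ioc (c + j) (c + N))
          (fun y => f y * w y * weight P (inside 𝓚 (c + j) (c + N)) y) x)
    (x : Conf S) :
    g * (∑ j ∈ J, renewal t j) * fiberSum (Finset.Ioc c (c + N))
        (fun y => w y * weight P (inside 𝓚 c (c + N)) y) x ≤
      C * fiberSum (Finset.Ioc c (c + N))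
        (fun y => f y * w y * weight P (inside 𝓚 c (c + N)) y) x := by
  have ht0 : ∀ d, 0 ≤ t d := fun d => by rw [ht]; exact varTail_nonneg _
  have hE : ∀ K ∈ inside 𝓚 c (c + N), K ∈ 𝓚 ∧ K.Nonempty ∧
      c < lowest K ∧ highest K ≤ c + N ∧ lowest K ≤ highest K := fun K hK => by
    obtain ⟨h1, h2⟩ := Finset.mem_filter.1 hK
    have h3 := hne K h1
    exact ⟨h1, h3, ((subset_Ioc_iff h3).1 h2).1, ((subset_Ioc_iff h3).1 h2).2,
      lowest_le (highest_mem h3)⟩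
  have hfilter : ∀ j : ℕ, (inside 𝓚 c (c + N)).filter
      (fun K => j < (lowest K - c).toNat) = inside 𝓚 (c + j) (c + N) := by
    intro j
    ext K
    by_cases hK : K ∈ 𝓚
    · simp only [inside, Finset.mem_filter, hK, true_and, subset_Ioc_iff (hne K hK)]
      omega
    · simp [inside, hK]
  have main := renewal_bound_fiberSum (S := S)
    (A := fun j : ℕ => Finset.Ioc (c + j) (c + N))
    (fun a b hab => Finset.Ioc_subset_Ioc_left (by omega)) N t
    (inside 𝓚 c (c + N)) (fun K => (lowest K - c).toNat)
    (fun K => (highest K - c).toNat) (defect P) (fun K => pvar (P.Φ K))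
    (fun _ _ => defect_nonneg P _) (fun _ _ => defect_le_pvar P _) ?_ ?_ ?_ ?_ w f hw0 hf J ?_
    C g ?_ hg0 ?_ ?_ x
  · simp only [Nat.cast_zero, add_zero] at main
    exact main
  · intro K hK x y hxy
    obtain ⟨-, h1, h2, h3, h4⟩ := hE K hK
    refine defect_congr P h1 fun i hi => hxy i ?_
    have := le_highest hi
    rw [Finset.mem_Ioc]
    omega
  · intro K hK
    have := hE K hK
    omega
  · intro K hK
    have := hE K hK
    omega
  · intro a i hai
    rw [ht]
    refine sum_pvar_le_of_mem hP _ _ (c + a) (fun K hK => ?_) (fun K hK => ?_)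
    · obtain ⟨h1, h2, h3⟩ := Finset.mem_filter.1 hK
      have := hE K h1
      have h4 : lowest K = c + a := by omega
      exact h4 ▸ lowest_mem this.2.1
    · obtain ⟨h1, h2, h3⟩ := Finset.mem_filter.1 hK
      have := hE K h1
      refine ⟨highest K, highest_mem this.2.1, ?_⟩
      push_cast [hai]
      omega
  · intro k hk
    have := Finset.mem_Icc.1 (hJ hk)
    omega
  · rw [hC]
    exact Finset.sum_nonneg fun _ _ => (renewal_pos t _).le
  · rw [hC]
    exact sum_renewal_shift_le ht0 hJ
  · intro j hj y
    simp only [hfilter]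
    exact hg j hj y

end Core

section Dichotomy

variable {S : Type} [Fintype S] [Nonempty S] [MeasurableSpace S] {P : Potential S}
  {t : ℕ → ℝ} {𝓚 : Finset (Finset ℤ)} {c : ℤ} {l N : ℕ} {C T : ℝ}

/-- The total variation of the interactions which join the bulk of `(c, c + N]` to its
complement. -/
lemma sum_pvar_crossing_le (hP : NormSummable P) (ht : ∀ d, t d = varTail P (d + 1))
    (hne : ∀ K ∈ 𝓚, K.Nonempty) :
    ∑ K ∈ 𝓚 with ¬ K ⊆ Finset.Ioc c (c + N) ∧
      ¬ Disjoint K (Finset.Ioc (c + l) (c + N - l)), pvar (P.Φ K) ≤ 2 * N * t l := by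
  set V := Finset.Ioc c (c + N) with hV
  have hcard : (V.card : ℝ) = N := by
    rw [hV, Int.card_Ioc]
    simp
  have h1 : ∀ a ∈ V, ∑ K ∈ 𝓚 with a ∈ K ∧ a + (l + 1 : ℕ) ≤ highest K, pvar (P.Φ K) ≤ t l := by
    intro a _
    rw [ht]
    refine sum_pvar_le_of_mem hP _ _ a (fun K hK => (Finset.mem_filter.1 hK).2.1) fun K hK => ?_
    obtain ⟨h1, h2, h3⟩ := Finset.mem_filter.1 hK
    exact ⟨highest K, highest_mem (hne K h1), h3⟩
  have h2 : ∀ b ∈ V, ∑ K ∈ 𝓚 with highest K = b ∧ lowest K + (l + 1 : ℕ) ≤ b,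
      pvar (P.Φ K) ≤ t l := by
    intro b _
    rw [ht]
    exact sum_pvar_le_of_highest hP _ _ b (fun K hK => hne K (Finset.mem_filter.1 hK).1)
      (fun K hK => (Finset.mem_filter.1 hK).2.1) fun K hK => (Finset.mem_filter.1 hK).2.2
  have h3 : 2 * N * t l = ∑ a ∈ V, (t l + t l) := by
    rw [Finset.sum_const, nsmul_eq_mul, hcard]
    ring
  rw [h3]
  refine le_trans ?_ (Finset.sum_le_sum fun a ha => add_le_add (h1 a ha) (h2 a ha))
  simp only [Finset.sum_filter]
  simp only [← Finset.sum_add_distrib]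
  rw [Finset.sum_comm]
  refine Finset.sum_le_sum fun K hK => ?_
  have hv := pvar_nonneg P K
  have h0 : ∀ a ∈ V, 0 ≤ (if a ∈ K ∧ a + (l + 1 : ℕ) ≤ highest K then pvar (P.Φ K) else 0) +
      if highest K = a ∧ lowest K + (l + 1 : ℕ) ≤ a then pvar (P.Φ K) else 0 := fun a _ =>
    add_nonneg (by split_ifs <;> simp [hv]) (by split_ifs <;> simp [hv])
  split_ifs with h
  · obtain ⟨hKV, hKM⟩ := h
    obtain ⟨a, haK, haM⟩ := Finset.not_disjoint_iff.1 hKM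
    rw [subset_Ioc_iff (hne K hK)] at hKV
    rw [Finset.mem_Ioc] at haM
    by_cases hb : highest K ≤ c + N
    · have hlow := lowest_le haK
      have hhigh := le_highest haK
      refine le_trans ?_ (Finset.single_le_sum h0
        (Finset.mem_Ioc.2 ⟨?_, hb⟩ : highest K ∈ V))
      · rw [if_pos (⟨rfl, by push_cast; omega⟩ : highest K = highest K ∧ _)]
        exact le_add_of_nonneg_left (by split_ifs <;> simp [hv])
      · omega
    · refine le_trans ?_ (Finset.single_le_sum h0 (Finset.mem_Ioc.2 ⟨?_, ?_⟩ : a ∈ V))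
      · rw [if_pos (⟨haK, by push_cast; omega⟩ : a ∈ K ∧ _)]
        exact le_add_of_nonneg_right (by split_ifs <;> simp [hv])
      · omega
      · omega
  · exact Finset.sum_nonneg h0

/-- The two-sided renewal argument. -/
lemma two_cuts (hP : NormSummable P) (ht : ∀ d, t d = varTail P (d + 1))
    (hne : ∀ K ∈ 𝓚, K.Nonempty) (hN : 4 * l < N) (f w : Conf S → ℝ)
    (hf : ∀ x, 0 ≤ f x) (hw0 : ∀ x, 0 ≤ w x)
    (hw : ∀ x y, (∀ i ∉ Finset.Ioc (c + l) (c + N - l), x i = y i) → w x = w y)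
    (hC : C = ∑ n ∈ Finset.range (l + 1), renewal t n) {δ : ℝ} (hδ0 : 0 ≤ δ)
    (J : Finset ℕ) (hJ : J ⊆ Finset.Icc l (2 * l)) (hJT : δ * C ≤ ∑ j ∈ J, renewal t j)
    (hg : ∀ j ∈ J, ∃ I ⊆ Finset.Icc l (2 * l), δ * C ≤ ∑ k ∈ I, renewal t k ∧ ∀ k ∈ I, ∀ x,
      1 / 2 * fiberSum (Finset.Ioc (c + j) (c + N - k))
          (weight P (inside 𝓚 (c + j) (c + N - k))) x ≤
        fiberSum (Finset.Ioc (c + j) (c + N - k))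
          (fun y => f y * weight P (inside 𝓚 (c + j) (c + N - k)) y) x)
    (x : Conf S) :
    δ ^ 2 / 2 * fiberSum (Finset.Ioc c (c + N))
        (fun y => w y * weight P (inside 𝓚 c (c + N)) y) x ≤
      fiberSum (Finset.Ioc c (c + N))
        (fun y => f y * w y * weight P (inside 𝓚 c (c + N)) y) x := by
  have hC0 : 0 < C := by
    rw [hC]
    exact Finset.sum_pos (fun _ _ => renewal_pos t _) ⟨0, by simp⟩
  have hnn : ∀ (V : Finset ℤ) (𝓕 : Finset (Finset ℤ)) (x : Conf S),
      0 ≤ fiberSum V (fun y => w y * weight P 𝓕 y) x := fun V 𝓕 x =>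
    fiberSum_nonneg (fun y => mul_nonneg (hw0 y) (weight_pos _ _).le) x
  have h1 := left_cut (c := c) hP ht hne hN f w hf hw0 J hJ (g := δ / 2) (by positivity) hC ?_ x
  · refine le_of_mul_le_mul_left (le_trans ?_ h1) hC0
    have := mul_le_mul_of_nonneg_right (mul_le_mul_of_nonneg_left hJT (by positivity : 0 ≤ δ / 2))
      (hnn (Finset.Ioc c (c + N)) (inside 𝓚 c (c + N)) x)
    linarith
  · intro j hj y
    obtain ⟨I, hI, hIT, hIg⟩ := hg j hj
    have hj' := Finset.mem_Icc.1 (hJ hj)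
    have h2 := right_cut hP ht hne hN f w hf hw0 (fun x y h => hw x y fun i hi => h i fun hi' =>
      hi (Finset.Ioc_subset_Ioc_left (by omega) hi')) I hI (by norm_num) hC hIg y
    refine le_of_mul_le_mul_left (le_trans ?_ h2) hC0
    have := mul_le_mul_of_nonneg_right
      (mul_le_mul_of_nonneg_left hIT (by norm_num : (0 : ℝ) ≤ 1 / 2))
      (hnn (Finset.Ioc (c + j) (c + N)) (inside 𝓚 (c + j) (c + N)) y)
    linarith

/-- A local function with values in `[0, 1]` is bounded below on average, or so is its
complement, uniformly in the boundary condition. -/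
lemma dichotomy (hP : NormSummable P) (ht : ∀ d, t d = varTail P (d + 1))
    (hne : ∀ K ∈ 𝓚, K.Nonempty) (hN : 4 * l < N) (f : Conf S → ℝ)
    (hf0 : ∀ x, 0 ≤ f x) (hf1 : ∀ x, f x ≤ 1)
    (hf : ∀ x y, (∀ i ∈ Finset.Ioc (c + 2 * l) (c + N - 2 * l), x i = y i) → f x = f y)
    {δ C₀ : ℝ} (hδ0 : 0 ≤ δ)
    (hδ : 2 * δ * ∑ n ∈ Finset.range (l + 1), renewal t n ≤
      ∑ n ∈ Finset.Icc l (2 * l), renewal t n)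
    (hC₀ : 2 * N * t l ≤ C₀) :
    (∀ x, Real.exp (-C₀) * (δ ^ 2 / 2) * fiberSum (Finset.Ioc c (c + N)) (weight P 𝓚) x ≤
      fiberSum (Finset.Ioc c (c + N)) (fun y => f y * weight P 𝓚 y) x) ∨
    (∀ x, Real.exp (-C₀) * (δ ^ 2 / 2) * fiberSum (Finset.Ioc c (c + N)) (weight P 𝓚) x ≤
      fiberSum (Finset.Ioc c (c + N)) (fun y => (1 - f y) * weight P 𝓚 y) x) := by
  classical
  set C := ∑ n ∈ Finset.range (l + 1), renewal t n with hC
  set V := Finset.Ioc c (c + N) with hV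
  set M := Finset.Ioc (c + l) (c + N - l) with hM
  set out := 𝓚.filter fun K => ¬ K ⊆ V ∧ Disjoint K M with hout
  set bad := 𝓚.filter fun K => ¬ K ⊆ V ∧ ¬ Disjoint K M with hbad
  have hsplit : ∀ y, weight P 𝓚 y = weight P out y * weight P (inside 𝓚 c (c + N)) y *
      weight P bad y := by
    intro y
    rw [← weight_union, ← weight_union]
    · congr 1
      ext K
      simp only [hout, hbad, inside, Finset.mem_union, Finset.mem_filter]
      tauto
    · rw [Finset.disjoint_left]
      intro K
      simp only [hout, hbad, inside, Finset.mem_union, Finset.mem_filter]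
      tauto
    · rw [Finset.disjoint_left]
      intro K
      simp only [hout, inside, Finset.mem_filter]
      tauto
  have hreduce : ∀ f : Conf S → ℝ, (∀ x, 0 ≤ f x) →
      (∀ x, δ ^ 2 / 2 * fiberSum V (fun y => weight P out y * weight P (inside 𝓚 c (c + N)) y) x ≤
        fiberSum V (fun y => f y * weight P out y * weight P (inside 𝓚 c (c + N)) y) x) →
      ∀ x, Real.exp (-C₀) * (δ ^ 2 / 2) * fiberSum V (weight P 𝓚) x ≤
        fiberSum V (fun y => f y * weight P 𝓚 y) x := by
    intro f hf h x
    have h1 : Real.exp (-C₀) * fiberSum V (weight P 𝓚) x ≤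
        fiberSum V (fun y => weight P out y * weight P (inside 𝓚 c (c + N)) y) x := by
      rw [← fiberSum_const_mul]
      refine fiberSum_mono fun y _ => ?_
      have := weight_le ((sum_pvar_crossing_le (c := c) hP ht hne).trans hC₀) y
      rw [hsplit]
      calc _ ≤ Real.exp (-C₀) * (weight P out y * weight P (inside 𝓚 c (c + N)) y *
            Real.exp C₀) := by
            have := mul_pos (weight_pos (P := P) out y) (weight_pos (P := P) (inside 𝓚 c (c + N)) y)
            gcongr
        _ = weight P out y * weight P (inside 𝓚 c (c + N)) y *
            (Real.exp (-C₀) * Real.exp C₀) := by ring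
        _ = _ := by rw [← Real.exp_add]; simp
    calc _ = δ ^ 2 / 2 * (Real.exp (-C₀) * fiberSum V (weight P 𝓚) x) := by ring
      _ ≤ δ ^ 2 / 2 *
          fiberSum V (fun y => weight P out y * weight P (inside 𝓚 c (c + N)) y) x :=
        mul_le_mul_of_nonneg_left h1 (by positivity)
      _ ≤ _ := (h x).trans (fiberSum_mono fun y _ => ?_)
    rw [hsplit, ← mul_assoc, ← mul_assoc]
    exact le_mul_of_one_le_right (mul_nonneg (mul_nonneg (hf y) (weight_pos _ _).le)
      (weight_pos _ _).le) (one_le_weight _ _)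
  have hw : ∀ x y : Conf S, (∀ i ∉ M, x i = y i) → weight P out x = weight P out y :=
    fun x y h => weight_congr (fun K hK => hne K (Finset.mem_filter.1 hK).1) fun K hK i hi =>
      h i (Finset.disjoint_left.1 (Finset.mem_filter.1 hK).2.2 hi)
  let good : (Conf S → ℝ) → ℕ → ℕ → Conf S → Prop := fun f j k x =>
    1 / 2 * fiberSum (Finset.Ioc (c + j) (c + N - k))
        (weight P (inside 𝓚 (c + j) (c + N - k))) x ≤
      fiberSum (Finset.Ioc (c + j) (c + N - k))
        (fun y => f y * weight P (inside 𝓚 (c + j) (c + N - k)) y) x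
  let x₀ : Conf S := Classical.arbitrary _
  have hlocal : ∀ f : Conf S → ℝ,
      (∀ x y, (∀ i ∈ Finset.Ioc (c + 2 * l) (c + N - 2 * l), x i = y i) → f x = f y) →
      ∀ j ∈ Finset.Icc l (2 * l), ∀ k ∈ Finset.Icc l (2 * l), good f j k x₀ →
        ∀ x, good f j k x := by
    intro f hf j hj k hk h x
    rw [Finset.mem_Icc] at hj hk
    have hconst : ∀ F : Conf S → ℝ, (∀ x y : Conf S,
        (∀ i ∈ Finset.Ioc (c + j) (c + N - k), x i = y i) → F x = F y) →
        fiberSum (Finset.Ioc (c + j) (c + N - k)) F x =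
          fiberSum (Finset.Ioc (c + j) (c + N - k)) F x₀ := fun F hF =>
      Finset.sum_congr rfl fun ζ _ => hF _ _ fun i hi => by rw [ov_of_mem _ _ hi, ov_of_mem _ _ hi]
    have hwt : ∀ x y : Conf S, (∀ i ∈ Finset.Ioc (c + j) (c + N - k), x i = y i) →
        weight P (inside 𝓚 (c + j) (c + N - k)) x = weight P (inside 𝓚 (c + j) (c + N - k)) y :=
      fun x y h => weight_congr (fun K hK => hne K (Finset.mem_filter.1 hK).1) fun K hK i hi =>
        h i ((Finset.mem_filter.1 hK).2 hi)
    simp only [good]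
    rw [hconst _ hwt, hconst _ fun x y h => ?_]
    · exact h
    · rw [hwt x y h, hf x y fun i hi => h i (Finset.Ioc_subset_Ioc (by omega) (by omega) hi)]
  have hgood : ∀ j k, ¬ good f j k x₀ → good (fun y => 1 - f y) j k x₀ := by
    intro j k h
    simp only [good, not_le] at h ⊢
    have : fiberSum (Finset.Ioc (c + j) (c + N - k))
          (fun y => f y * weight P (inside 𝓚 (c + j) (c + N - k)) y) x₀ +
        fiberSum (Finset.Ioc (c + j) (c + N - k))
          (fun y => (1 - f y) * weight P (inside 𝓚 (c + j) (c + N - k)) y) x₀ =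
        fiberSum (Finset.Ioc (c + j) (c + N - k))
          (weight P (inside 𝓚 (c + j) (c + N - k))) x₀ := by
      rw [fiberSum, fiberSum, fiberSum, ← Finset.sum_add_distrib]
      exact Finset.sum_congr rfl fun _ _ => by ring
    linarith
  have hhalf : ∀ p : ℕ → Prop, δ * C ≤ ∑ k ∈ (Finset.Icc l (2 * l)).filter p, renewal t k ∨
      δ * C ≤ ∑ k ∈ (Finset.Icc l (2 * l)).filter fun k => ¬ p k, renewal t k := by
    intro p
    have := Finset.sum_filter_add_sum_filter_not (Finset.Icc l (2 * l)) p (renewal t)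
    by_contra! h
    linarith
  let p : ℕ → Prop := fun j =>
    δ * C ≤ ∑ k ∈ (Finset.Icc l (2 * l)).filter fun k => good f j k x₀, renewal t k
  have hfin : ∀ f : Conf S → ℝ, (∀ x, 0 ≤ f x) →
      (∀ x y, (∀ i ∈ Finset.Ioc (c + 2 * l) (c + N - 2 * l), x i = y i) → f x = f y) →
      ∀ q : ℕ → Prop, δ * C ≤ ∑ k ∈ (Finset.Icc l (2 * l)).filter q, renewal t k →
      (∀ j, q j → ∃ r : ℕ → Prop, δ * C ≤ ∑ k ∈ (Finset.Icc l (2 * l)).filter r, renewal t k ∧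
        ∀ k, r k → good f j k x₀) →
      ∀ x, Real.exp (-C₀) * (δ ^ 2 / 2) * fiberSum V (weight P 𝓚) x ≤
        fiberSum V (fun y => f y * weight P 𝓚 y) x := by
    intro f hf0 hf q hq h
    refine hreduce f hf0 (two_cuts hP ht hne hN f _ hf0 (fun x => (weight_pos out x).le) hw hC hδ0
      ((Finset.Icc l (2 * l)).filter q) (Finset.filter_subset _ _) hq fun j hj => ?_)
    obtain ⟨r, hr, hrg⟩ := h j (Finset.mem_filter.1 hj).2
    refine ⟨(Finset.Icc l (2 * l)).filter r, Finset.filter_subset _ _, hr, fun k hk => ?_⟩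
    exact hlocal f hf j (Finset.mem_filter.1 hj).1 k (Finset.mem_filter.1 hk).1
      (hrg k (Finset.mem_filter.1 hk).2)
  rcases hhalf p with h | h
  · exact Or.inl (hfin f hf0 hf p h fun j hj => ⟨_, hj, fun k hk => hk⟩)
  · refine Or.inr (hfin _ (fun x => sub_nonneg.2 (hf1 x))
      (fun x y h => by rw [hf x y h]) (fun j => ¬ p j) (by convert h) fun j hj =>
      ⟨fun k => ¬ good f j k x₀, ?_, fun k hk => hgood j k hk⟩)
    convert (hhalf _).resolve_left hj

end Dichotomy

section Scales

lemma sum_rpow_neg_le {s : ℝ} (hs0 : 0 ≤ s) (hs1 : s < 1) (m : ℕ) :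
    ∑ i ∈ Finset.range m, ((i : ℝ) + 1) ^ (-s) ≤ (m : ℝ) ^ (1 - s) / (1 - s) := by
  have hs : 0 < 1 - s := by linarith
  induction m with
  | zero =>
    simp only [Finset.range_zero, Finset.sum_empty]
    positivity
  | succ m ih =>
    rw [Finset.sum_range_succ]
    have hm : (0 : ℝ) < m + 1 := by positivity
    have h1 := rpow_one_add_le_one_add_mul_self (s := -1 / ((m : ℝ) + 1)) (p := 1 - s)
      (by rw [le_div_iff₀ hm]; linarith [(Nat.cast_nonneg m : (0 : ℝ) ≤ m)]) hs.le (by linarith)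
    have h2 : (m : ℝ) ^ (1 - s) =
        ((m : ℝ) + 1) ^ (1 - s) * (1 + -1 / ((m : ℝ) + 1)) ^ (1 - s) := by
      have h3 : 1 + -1 / ((m : ℝ) + 1) = m / (m + 1) := by
        field_simp
        ring
      rw [h3, ← Real.mul_rpow hm.le (by positivity)]
      congr 1
      field_simp
    have h4 : ((m : ℝ) + 1) ^ (1 - s) * (1 / (m + 1)) = ((m : ℝ) + 1) ^ (-s) := by
      rw [sub_eq_add_neg, Real.rpow_add hm, Real.rpow_one]
      field_simp
    have h5 : (m : ℝ) ^ (1 - s) ≤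
        ((m : ℝ) + 1) ^ (1 - s) - (1 - s) * ((m : ℝ) + 1) ^ (-s) := by
      rw [h2, ← h4]
      have := mul_le_mul_of_nonneg_left h1 (Real.rpow_nonneg hm.le (1 - s))
      refine this.trans (le_of_eq ?_)
      ring
    push_cast
    rw [le_div_iff₀ hs] at ih ⊢
    linarith

/-- Under a logarithmic bound on the partial sums of `t`, there are arbitrarily large scales at
which the renewal sequence is regular and `t` is at most of order `1 / N`. -/
lemma exists_scales {t : ℕ → ℝ} (ht0 : ∀ d, 0 ≤ t d) (ht : Antitone t) {K α : ℝ} (hK : 0 < K)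
    (hα0 : 0 < α) (hα1 : α ≤ 1)
    (h : ∀ n : ℕ, 1 ≤ n →
      ∑ i ∈ Finset.range (n + 1), t i ≤ (1 - α) * Real.log n + Real.log K) :
    ∃ δ > 0, ∃ C₀ : ℝ, ∀ m : ℕ, ∃ l N : ℕ, 4 * l < N ∧ m ≤ N - 4 * l ∧
      2 * δ * ∑ n ∈ Finset.range (l + 1), renewal t n ≤
        ∑ n ∈ Finset.Icc l (2 * l), renewal t n ∧
      2 * N * t l ≤ C₀ := by
  set s : ℝ := 1 - α / 2 with hs
  have hs0 : 0 < s := by linarith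
  have hs1 : s < 1 := by linarith
  have htend : Tendsto (fun n : ℕ => (n : ℝ) ^ s * renewal t n) atTop atTop := by
    rw [← tendsto_add_atTop_iff_nat 1]
    have h1 : Tendsto (fun n : ℕ => (n : ℝ) ^ (α / 2) / K) atTop atTop :=
      ((tendsto_rpow_atTop (by positivity)).comp tendsto_natCast_atTop_atTop).atTop_div_const hK
    refine tendsto_atTop_mono' _ ?_ h1
    filter_upwards [eventually_ge_atTop 1] with n hn
    have hn0 : (0 : ℝ) < n := by exact_mod_cast hn
    have h2 : (n : ℝ) ^ (-(1 - α)) / K ≤ renewal t (n + 1) := by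
      rw [renewal, Real.rpow_def_of_pos hn0, ← Real.exp_log hK, ← Real.exp_sub,
        Real.exp_le_exp]
      linarith [h n hn]
    have h3 : (n : ℝ) ^ s ≤ ((n + 1 : ℕ) : ℝ) ^ s :=
      Real.rpow_le_rpow hn0.le (by push_cast; linarith) hs0.le
    calc (n : ℝ) ^ (α / 2) / K = (n : ℝ) ^ s * ((n : ℝ) ^ (-(1 - α)) / K) := by
          rw [← mul_div_assoc, ← Real.rpow_add hn0]
          congr 2
          rw [hs]
          ring
      _ ≤ _ := mul_le_mul h3 h2 (by positivity) (by positivity)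
  set D : ℝ := Real.exp (t 0) + 1 / (1 - s) with hD
  have hD0 : 0 < D := add_pos (Real.exp_pos _) (by rw [one_div_pos]; linarith)
  refine ⟨1 / (10 * D), by positivity, 24 * Real.log 18, fun m => ?_⟩
  obtain ⟨N, hN, hmax⟩ := Filter.high_scores htend (max 100 (5 * m))
  have hN100 : 100 ≤ N := (le_max_left _ _).trans hN
  have hNm : 5 * m ≤ N := (le_max_right _ _).trans hN
  have hN0 : (0 : ℝ) < N := by exact_mod_cast (by omega : 0 < N)
  have hu0 := renewal_pos t N
  have hmax' : ∀ n : ℕ, n < N → (n : ℝ) ^ s * renewal t n ≤ (N : ℝ) ^ s * renewal t N :=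
    fun n hn => (hmax n hn).le
  obtain ⟨l, hl⟩ : ∃ l, l = N / 5 := ⟨_, rfl⟩
  refine ⟨l, N, by omega, by omega, ?_, ?_⟩
  · have h1 : ∑ n ∈ Finset.range (l + 1), renewal t n ≤ D * (N * renewal t N) := by
      rw [Finset.sum_range_succ', renewal_zero]
      have h2 : ∑ i ∈ Finset.range l, renewal t (i + 1) ≤
          1 / (1 - s) * (N * renewal t N) := by
        calc _ ≤ ∑ i ∈ Finset.range l, (N : ℝ) ^ s * renewal t N * ((i : ℝ) + 1) ^ (-s) := by
              refine Finset.sum_le_sum fun i hi => ?_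
              have hi0 : (0 : ℝ) < i + 1 := by positivity
              have := hmax' (i + 1) (by have := Finset.mem_range.1 hi; omega)
              push_cast at this
              rw [Real.rpow_neg hi0.le, ← div_eq_mul_inv, le_div_iff₀ (by positivity), mul_comm]
              exact this
          _ ≤ (N : ℝ) ^ s * renewal t N * ((N : ℝ) ^ (1 - s) / (1 - s)) := by
              rw [← Finset.mul_sum]
              refine mul_le_mul_of_nonneg_left ((sum_rpow_neg_le hs0.le hs1 l).trans ?_)
                (by positivity)
              refine div_le_div_of_nonneg_right (Real.rpow_le_rpow (by positivity) ?_ ?_) ?_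
              · exact_mod_cast (by omega : l ≤ N)
              · linarith
              · linarith
          _ = 1 / (1 - s) * ((N : ℝ) ^ s * (N : ℝ) ^ (1 - s) * renewal t N) := by ring
          _ = _ := by rw [← Real.rpow_add hN0]; simp
      have h3 : 1 ≤ Real.exp (t 0) * (N * renewal t N) := by
        have h4 := hmax' 1 (by omega)
        rw [renewal_succ, renewal_zero] at h4
        simp only [Nat.cast_one, Real.one_rpow, one_mul, mul_one] at h4
        have h5 : (N : ℝ) ^ s ≤ N := by
          conv_rhs => rw [← Real.rpow_one (N : ℝ)]
          exact Real.rpow_le_rpow_of_exponent_le (by exact_mod_cast (by omega : 1 ≤ N)) hs1.le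
        calc (1 : ℝ) = Real.exp (t 0) * Real.exp (-t 0) := by rw [← Real.exp_add]; simp
          _ ≤ Real.exp (t 0) * (N * renewal t N) := by
            refine mul_le_mul_of_nonneg_left (h4.trans ?_) (Real.exp_pos _).le
            exact mul_le_mul_of_nonneg_right h5 hu0.le
      rw [hD, add_mul]
      linarith
    have h2 : ((l : ℝ) + 1) * renewal t N ≤ ∑ n ∈ Finset.Icc l (2 * l), renewal t n := by
      have := Finset.card_nsmul_le_sum (Finset.Icc l (2 * l)) (renewal t) (renewal t N)
        fun n hn => renewal_antitone ht0 (by have := Finset.mem_Icc.1 hn; omega)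
      rw [Nat.card_Icc, nsmul_eq_mul, show 2 * l + 1 - l = l + 1 by omega] at this
      exact_mod_cast this
    have h3 : (N : ℝ) ≤ 5 * (l + 1) := by exact_mod_cast (by omega : N ≤ 5 * (l + 1))
    calc 2 * (1 / (10 * D)) * ∑ n ∈ Finset.range (l + 1), renewal t n
        ≤ 2 * (1 / (10 * D)) * (D * (N * renewal t N)) :=
          mul_le_mul_of_nonneg_left h1 (by positivity)
      _ = N / 5 * renewal t N := by field_simp; norm_num
      _ ≤ (l + 1) * renewal t N := mul_le_mul_of_nonneg_right (by linarith) hu0.le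
      _ ≤ _ := h2
  · obtain ⟨n, hn⟩ : ∃ n, n = l / 2 := ⟨_, rfl⟩
    have hn0 : (0 : ℝ) < n := by exact_mod_cast (by omega : 0 < n)
    have h1 := Real.log_le_log (mul_pos (Real.rpow_pos_of_pos hn0 s) (renewal_pos t n))
      (hmax' n (by omega))
    rw [Real.log_mul (Real.rpow_pos_of_pos hn0 s).ne' (renewal_pos t n).ne',
      Real.log_mul (Real.rpow_pos_of_pos hN0 s).ne' hu0.ne', Real.log_rpow hn0,
      Real.log_rpow hN0, renewal, renewal, Real.log_exp, Real.log_exp] at h1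
    have h2 := Finset.sum_range_add_sum_Ico t (by omega : n ≤ N)
    have h3 : ((l : ℝ) - n) * t l ≤ ∑ i ∈ Finset.Ico n N, t i := by
      have h4 := Finset.card_nsmul_le_sum (Finset.Ico n l) t (t l)
        fun i hi => ht (Finset.mem_Ico.1 hi).2.le
      rw [Nat.card_Ico, nsmul_eq_mul, Nat.cast_sub (by omega)] at h4
      exact h4.trans (Finset.sum_le_sum_of_subset_of_nonneg
        (Finset.Ico_subset_Ico_right (by omega)) fun i _ _ => ht0 i)
    have h4 : Real.log N ≤ Real.log 18 + Real.log n := by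
      rw [← Real.log_mul (by norm_num) hn0.ne']
      exact Real.log_le_log hN0 (by exact_mod_cast (by omega : N ≤ 18 * n))
    have h5 : 0 ≤ Real.log N - Real.log n :=
      sub_nonneg.2 (Real.log_le_log hn0 (by exact_mod_cast (by omega : n ≤ N)))
    have h6 : (N : ℝ) ≤ 12 * (l - n) := by
      have : N + 12 * n ≤ 12 * l := by omega
      have : (N : ℝ) + 12 * n ≤ 12 * l := by exact_mod_cast this
      linarith
    have h7 : ∑ i ∈ Finset.Ico n N, t i ≤ Real.log 18 := by nlinarith
    nlinarith [mul_le_mul_of_nonneg_right h6 (ht0 l)]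

end Scales

section InfiniteVolume

variable {S : Type} [Fintype S] [MeasurableSpace S] {P : Potential S}

lemma summable_pnorm_of_mem (hP : NormSummable P) (i : ℤ) :
    Summable fun K : {K : Finset ℤ // i ∈ K} => pnorm (P.Φ K) := by
  let e : {K : Finset ℤ // i ∈ K} → {K : Finset ℤ // (0 : ℤ) ∈ K} := fun K =>
    ⟨(K : Finset ℤ).image fun j => -i + j, mem_translate.2 (by simpa using K.2)⟩
  have he : Function.Injective e := fun K L h =>
    Subtype.ext (translate_injective _ (congrArg Subtype.val h))
  refine (hP.comp_injective he).congr fun K => ?_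
  exact pnorm_translate P ⟨i, K.2⟩ _

omit [Fintype S] [MeasurableSpace S] in
lemma pnorm_nonneg (h : Conf S → ℝ) : 0 ≤ pnorm h := Real.iSup_nonneg fun _ => abs_nonneg _

lemma summable_pnorm_of_inter (hP : NormSummable P) (V : Finset ℤ) :
    Summable fun K : {K : Finset ℤ // (K ∩ V).Nonempty} => pnorm (P.Φ K) := by
  have h1 : ∀ i : ℤ, Summable ({K : Finset ℤ | i ∈ K}.indicator fun K => pnorm (P.Φ K)) :=
    fun i => summable_subtype_iff_indicator.1 (summable_pnorm_of_mem hP i)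
  suffices h2 : Summable ({K : Finset ℤ | (K ∩ V).Nonempty}.indicator fun K => pnorm (P.Φ K)) from
    summable_subtype_iff_indicator.2 h2
  refine Summable.of_nonneg_of_le
    (f := fun K => ∑ i ∈ V, {K : Finset ℤ | i ∈ K}.indicator (fun K => pnorm (P.Φ K)) K)
    (fun K => Set.indicator_nonneg (fun _ _ => pnorm_nonneg _) K) (fun K => ?_)
    (summable_sum fun i _ => h1 i)
  have h0 : ∀ i ∈ V, 0 ≤ {K : Finset ℤ | i ∈ K}.indicator (fun K => pnorm (P.Φ K)) K :=
    fun i _ => Set.indicator_nonneg (fun _ _ => pnorm_nonneg _) K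
  by_cases hK : (K ∩ V).Nonempty
  · obtain ⟨i, hi⟩ := hK
    obtain ⟨hiK, hiV⟩ := Finset.mem_inter.1 hi
    refine le_trans ?_ (Finset.single_le_sum h0 hiV)
    rw [Set.indicator_of_mem (show K ∈ {K : Finset ℤ | i ∈ K} from hiK)]
    exact Set.indicator_le_self' (fun _ _ => pnorm_nonneg _) K
  · rw [Set.indicator_of_notMem (by exact hK)]
    exact Finset.sum_nonneg h0

lemma summable_HPot (hP : NormSummable P) (V : Finset ℤ) (x : Conf S) :
    Summable fun K : {K : Finset ℤ // (K ∩ V).Nonempty} => P.Φ K x :=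
  Summable.of_norm_bounded (summable_pnorm_of_inter hP V) fun K => P.abs_le_pnorm K x

/-- The partition function. -/
def partition (P : Potential S) (V : Finset ℤ) : Conf S → ℝ :=
  fiberSum V fun y => Real.exp (-HPot P V y)

/-- The average of `f` under the finite-volume Gibbs measure with boundary condition `x`. -/
def gibbsAvg (P : Potential S) (V : Finset ℤ) (f : Conf S → ℝ) : Conf S → ℝ :=
  fiberSum V fun y => potPhi P V y * f y

lemma potPhi_eq (V : Finset ℤ) (x : Conf S) :
    potPhi P V x = Real.exp (-HPot P V x) / partition P V x := rfl

lemma partition_pos [Nonempty S] (V : Finset ℤ) (x : Conf S) : 0 < partition P V x :=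
  fiberSum_pos (fun _ => Real.exp_pos _) x

lemma partition_congr {V : Finset ℤ} {x y : Conf S} (h : ∀ i ∉ V, x i = y i) :
    partition P V x = partition P V y := fiberSum_congr _ h

lemma potPhi_pos [Nonempty S] (V : Finset ℤ) (x : Conf S) : 0 < potPhi P V x :=
  div_pos (Real.exp_pos _) (partition_pos V x)

lemma gibbsAvg_eq (V : Finset ℤ) (f : Conf S → ℝ) (x : Conf S) :
    gibbsAvg P V f x = fiberSum V (fun y => f y * Real.exp (-HPot P V y)) x / partition P V x := by
  rw [gibbsAvg, fiberSum, fiberSum, Finset.sum_div]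
  refine Finset.sum_congr rfl fun ζ _ => ?_
  rw [potPhi_eq, partition_congr fun i hi => ov_of_notMem x ζ hi]
  ring

lemma gibbsAvg_one [Nonempty S] (V : Finset ℤ) (x : Conf S) :
    gibbsAvg P V (fun _ => 1) x = 1 := by
  rw [gibbsAvg_eq]
  simp only [one_mul]
  exact div_self (partition_pos V x).ne'

lemma gibbsAvg_one_sub [Nonempty S] (V : Finset ℤ) (f : Conf S → ℝ) (x : Conf S) :
    gibbsAvg P V (fun y => 1 - f y) x = 1 - gibbsAvg P V f x := by
  rw [eq_sub_iff_add_eq]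
  refine Eq.trans ?_ (gibbsAvg_one (P := P) V x)
  rw [gibbsAvg, gibbsAvg, gibbsAvg, fiberSum, fiberSum, fiberSum, ← Finset.sum_add_distrib]
  exact Finset.sum_congr rfl fun _ _ => by ring

/-- A lower bound in the presence of finitely many interactions passes to the limit. -/
lemma le_gibbsAvg_of_frequently [Nonempty S] (hP : NormSummable P) {V : Finset ℤ} {δ : ℝ}
    {f : Conf S → ℝ}
    (h : ∃ᶠ 𝓚 : Finset {K : Finset ℤ // (K ∩ V).Nonempty} in atTop, ∀ x,
      δ * fiberSum V (weight P (𝓚.map (Function.Embedding.subtype _))) x ≤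
        fiberSum V (fun y => f y * weight P (𝓚.map (Function.Embedding.subtype _)) y) x)
    (x : Conf S) : δ ≤ gibbsAvg P V f x := by
  have hw : ∀ (𝓚 : Finset {K : Finset ℤ // (K ∩ V).Nonempty}) (y : Conf S),
      weight P (𝓚.map (Function.Embedding.subtype _)) y =
        Real.exp (∑ K ∈ 𝓚, ⨆ z, P.Φ K z) * Real.exp (-∑ K ∈ 𝓚, P.Φ K y) := by
    intro 𝓚 y
    rw [weight, Finset.sum_map, ← Real.exp_add, ← sub_eq_add_neg, ← Finset.sum_sub_distrib]
    rfl
  have hlim : ∀ y, Tendsto (fun 𝓚 : Finset {K : Finset ℤ // (K ∩ V).Nonempty} =>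
      Real.exp (-∑ K ∈ 𝓚, P.Φ K y)) atTop (nhds (Real.exp (-HPot P V y))) := fun y => by
    have h1 : Tendsto (fun 𝓚 : Finset {K : Finset ℤ // (K ∩ V).Nonempty} => ∑ K ∈ 𝓚, P.Φ K y)
      atTop (nhds (HPot P V y)) := (summable_HPot hP V y).hasSum
    exact (Real.continuous_exp.tendsto _).comp h1.neg
  rw [gibbsAvg_eq, le_div_iff₀ (partition_pos V x)]
  refine le_of_tendsto_of_tendsto_of_frequently
    (f := fun 𝓚 : Finset {K : Finset ℤ // (K ∩ V).Nonempty} =>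
      δ * fiberSum V (fun y => Real.exp (-∑ K ∈ 𝓚, P.Φ K y)) x)
    (g := fun 𝓚 : Finset {K : Finset ℤ // (K ∩ V).Nonempty} =>
      fiberSum V (fun y => f y * Real.exp (-∑ K ∈ 𝓚, P.Φ K y)) x)
    ((tendsto_finsetSum _ fun ζ _ => hlim _).const_mul δ)
    (tendsto_finsetSum _ fun ζ _ => (hlim _).const_mul _) (h.mono fun 𝓚 h𝓚 => ?_)
  have h1 := h𝓚 x
  have e1 : weight P (𝓚.map (Function.Embedding.subtype _)) = fun y =>
      Real.exp (∑ K ∈ 𝓚, ⨆ z, P.Φ K z) * Real.exp (-∑ K ∈ 𝓚, P.Φ K y) := funext (hw 𝓚)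
  have e2 : (fun y => f y * weight P (𝓚.map (Function.Embedding.subtype _)) y) = fun y =>
      Real.exp (∑ K ∈ 𝓚, ⨆ z, P.Φ K z) * (f y * Real.exp (-∑ K ∈ 𝓚, P.Φ K y)) := by
    funext y
    rw [hw]
    ring
  rw [e2, e1, fiberSum_const_mul, fiberSum_const_mul, mul_left_comm] at h1
  exact le_of_mul_le_mul_left h1 (Real.exp_pos _)

/-- Uniform mixing: every local function with values in `[0, 1]`, or its complement, is bounded
below on average by a constant which depends neither on the function nor on the boundary
condition. -/
lemma exists_le_gibbsAvg [Nonempty S] (hP : NormSummable P) {K α : ℝ} (hK : 0 < K)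
    (hα0 : 0 < α) (hα1 : α ≤ 1)
    (h : ∀ n : ℕ, 1 ≤ n →
      ∑ i ∈ Finset.range (n + 1), varTail P (i + 1) ≤ (1 - α) * Real.log n + Real.log K) :
    ∃ δ > 0, ∀ W : Finset ℤ, ∃ V : Finset ℤ, V.Nonempty ∧ ∀ f : Conf S → ℝ, (∀ x, 0 ≤ f x) →
      (∀ x, f x ≤ 1) → (∀ x y, (∀ i ∈ W, x i = y i) → f x = f y) →
      (∀ x, δ ≤ gibbsAvg P V f x) ∨ ∀ x, δ ≤ gibbsAvg P V (fun y => 1 - f y) x := by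
  obtain ⟨δ, hδ, C₀, hscale⟩ := exists_scales (t := fun d => varTail P (d + 1))
    (fun d => varTail_nonneg _) (fun a b hab => varTail_antitone hP (by omega)) hK hα0 hα1 h
  refine ⟨Real.exp (-C₀) * (δ ^ 2 / 2), by positivity, fun W => ?_⟩
  obtain ⟨m, hm⟩ : ∃ m : ℕ, ∀ i ∈ W, |i| ≤ m :=
    ⟨W.sup Int.natAbs, fun i hi => by
      have : i.natAbs ≤ W.sup Int.natAbs := Finset.le_sup hi
      rw [Int.abs_eq_natAbs]
      exact_mod_cast this⟩
  obtain ⟨l, N, hlN, hmN, hren, ht⟩ := hscale (2 * m + 1)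
  obtain ⟨c, hc⟩ : ∃ c : ℤ, c = -m - 1 - 2 * l := ⟨_, rfl⟩
  refine ⟨Finset.Ioc c (c + N), ⟨c + 1, Finset.mem_Ioc.2 (by omega)⟩, fun f hf0 hf1 hf => ?_⟩
  have hf' : ∀ x y : Conf S,
      (∀ i ∈ Finset.Ioc (c + 2 * l) (c + N - 2 * l), x i = y i) → f x = f y :=
    fun x y hxy => hf x y fun i hi => hxy i <| by
      have := abs_le.1 (hm i hi)
      rw [Finset.mem_Ioc]
      omega
  have hfreq := Filter.frequently_or_distrib.1 (Frequently.of_forall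
    (f := (atTop : Filter (Finset {K : Finset ℤ // (K ∩ Finset.Ioc c (c + N)).Nonempty})))
    fun 𝓚 => dichotomy (𝓚 := 𝓚.map (Function.Embedding.subtype _)) hP (fun _ => rfl)
      (fun K hK => by
        obtain ⟨L, -, rfl⟩ := Finset.mem_map.1 hK
        exact L.2.mono Finset.inter_subset_left) hlN f hf0 hf1 hf' hδ.le hren ht)
  exact hfreq.imp (le_gibbsAvg_of_frequently hP) (le_gibbsAvg_of_frequently hP)

end InfiniteVolume

section Uniqueness

/-- The difference of the integrals of a function with values in `[0, c]` is at most `c` times the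
largest difference of the measures of a set. -/
lemma integral_sub_integral_le {X : Type*} [MeasurableSpace X] {μ ν : Measure X}
    [IsFiniteMeasure μ] [IsFiniteMeasure ν] {A : Set X} (hA : IsHahnDecomposition ν μ A)
    {h : X → ℝ} {c : ℝ} (hμ : Integrable h μ) (hν : Integrable h ν) (h0 : ∀ x, 0 ≤ h x)
    (hc : ∀ x, h x ≤ c) : ∫ x, h x ∂μ - ∫ x, h x ∂ν ≤ c * (μ.real A - ν.real A) := by
  have h1 : ∫ x in A, (c - h x) ∂ν ≤ ∫ x in A, (c - h x) ∂μ :=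
    integral_mono_measure hA.le_on (Eventually.of_forall fun x => sub_nonneg.2 (hc x))
      ((integrable_const c).sub hμ.restrict)
  have h2 : ∫ x in Aᶜ, h x ∂μ ≤ ∫ x in Aᶜ, h x ∂ν :=
    integral_mono_measure hA.ge_on_compl (Eventually.of_forall h0) hν.restrict
  rw [integral_sub (integrable_const c) hμ.restrict, integral_sub (integrable_const c) hν.restrict,
    setIntegral_const, setIntegral_const, smul_eq_mul, smul_eq_mul] at h1
  rw [← integral_add_compl hA.measurableSet hμ, ← integral_add_compl hA.measurableSet hν]
  linarith

/-- Two probability measures coincide if averaging contracts the oscillation of the members of a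
generating algebra by a uniform factor. -/
lemma eq_of_forall_mem_setAlgebra {X : Type*} [m : MeasurableSpace X] {μ ν : Measure X}
    [IsProbabilityMeasure μ] [IsProbabilityMeasure ν] {𝒜 : Set (Set X)} (h𝒜 : IsSetAlgebra 𝒜)
    (hgen : m = MeasurableSpace.generateFrom 𝒜) {δ : ℝ} (hδ : 0 < δ)
    (h : ∀ B ∈ 𝒜, ∃ (g : X → ℝ) (a : ℝ), Integrable g μ ∧ Integrable g ν ∧
      (∀ x, a ≤ g x) ∧ (∀ x, g x ≤ a + (1 - δ)) ∧ ∫ x, g x ∂μ = μ.real B ∧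
      ∫ x, g x ∂ν = ν.real B) : μ = ν := by
  obtain ⟨A, hA⟩ := exists_isHahnDecomposition ν μ
  have hd : μ.real A - ν.real A ≤ 0 := by
    by_contra! hd
    obtain ⟨B, hB, hAB⟩ := (Measure.MeasureDense.of_generateFrom_isSetAlgebra_finite
      (μ := μ + ν) h𝒜 hgen).approx A hA.measurableSet (measure_ne_top _ _)
      (δ * (μ.real A - ν.real A)) (mul_pos hδ hd)
    have hBm : MeasurableSet B := by
      rw [hgen]
      exact MeasurableSpace.measurableSet_generateFrom hB
    have h1 := abs_le.1 (abs_measureReal_sub_le_measureReal_symmDiff (μ := μ)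
      hA.measurableSet.nullMeasurableSet hBm.nullMeasurableSet)
    have h2 := abs_le.1 (abs_measureReal_sub_le_measureReal_symmDiff (μ := ν)
      hA.measurableSet.nullMeasurableSet hBm.nullMeasurableSet)
    have h3 : μ.real (symmDiff A B) + ν.real (symmDiff A B) < δ * (μ.real A - ν.real A) := by
      rw [← measureReal_add_apply, measureReal_def]
      exact (ENNReal.lt_ofReal_iff_toReal_lt (measure_ne_top _ _)).1 hAB
    obtain ⟨g, a, hgμ, hgν, hga, hgb, hμ, hν⟩ := h B hB
    have h4 := integral_sub_integral_le hA (h := fun x => g x - a) (c := 1 - δ)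
      (hgμ.sub (integrable_const a)) (hgν.sub (integrable_const a))
      (fun x => sub_nonneg.2 (hga x)) (fun x => by linarith [hgb x])
    rw [integral_sub hgμ (integrable_const a), integral_sub hgν (integrable_const a), hμ, hν] at h4
    simp only [integral_const, probReal_univ, one_smul] at h4
    linarith
  have hle : ∀ C, MeasurableSet C → μ.real C ≤ ν.real C := fun C hC => by
    have h1 := integral_sub_integral_le hA (h := C.indicator 1) (c := 1)
      ((integrable_const (1 : ℝ)).indicator hC) ((integrable_const (1 : ℝ)).indicator hC)
      (Set.indicator_nonneg fun _ _ => zero_le_one)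
      (Set.indicator_le_self' fun _ _ => zero_le_one)
    rw [integral_indicator_one hC, integral_indicator_one hC] at h1
    linarith
  refine Measure.ext fun C hC => ?_
  have h1 := hle C hC
  have h2 := hle Cᶜ hC.compl
  rw [probReal_compl_eq_one_sub hC, probReal_compl_eq_one_sub hC] at h2
  exact (ENNReal.toReal_eq_toReal_iff' (measure_ne_top _ _) (measure_ne_top _ _)).1
    (le_antisymm h1 (by simp only [measureReal_def] at h2; linarith!))

variable {S : Type} [MeasurableSpace S]

lemma cylSA_le (Λ : Set ℤ) : cylSA Λ ≤ (inferInstance : MeasurableSpace (Conf S)) :=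
  Measurable.comap_le (f := fun x : Conf S => Λ.domRestrict x)
    (measurable_pi_lambda _ fun i => measurable_pi_apply (i : ℤ))

lemma measurable_cylSA_apply {Λ : Set ℤ} {i : ℤ} (hi : i ∈ Λ) :
    Measurable[cylSA Λ] fun x : Conf S => x i :=
  (measurable_pi_apply (⟨i, hi⟩ : Λ)).comp (comap_measurable fun x : Conf S => Λ.domRestrict x)

lemma measurable_ov (Λ : Finset ℤ) (ζ : Λ → S) :
    Measurable[cylSA ((Λ : Set ℤ)ᶜ)] fun x : Conf S => ov x Λ ζ := by
  refine @measurable_pi_lambda _ _ _ (cylSA ((Λ : Set ℤ)ᶜ)) _ _ fun i => ?_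
  by_cases hi : i ∈ Λ
  · simp only [ov_of_mem _ _ hi]
    exact @measurable_const _ _ _ (cylSA ((Λ : Set ℤ)ᶜ)) _
  · simp only [ov_of_notMem _ _ hi]
    exact measurable_cylSA_apply (by simpa using hi)

lemma measurableSet_cylEvent [MeasurableSingletonClass S] (Λ : Finset ℤ) (ζ : Λ → S) :
    MeasurableSet (cylEvent Λ ζ) := by
  have : cylEvent Λ ζ = ⋂ i : Λ, (fun y : Conf S => y i) ⁻¹' {ζ i} := by
    ext y
    simp [cylEvent]
  rw [this]
  exact MeasurableSet.iInter fun i => measurable_pi_apply (i : ℤ) (measurableSet_singleton _)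

omit [MeasurableSpace S] in
lemma ov_eq_self_of_mem {Λ : Finset ℤ} {ζ : Λ → S} {x : Conf S} (h : x ∈ cylEvent Λ ζ) :
    ov x Λ ζ = x := by
  funext i
  by_cases hi : i ∈ Λ
  · rw [ov_of_mem _ _ hi, h ⟨i, hi⟩]
  · rw [ov_of_notMem _ _ hi]

/-- The DLR equation. -/
lemma GibbsCond.integral_fiberSum [Fintype S] [MeasurableSingletonClass S]
    {φ : Finset ℤ → Conf S → ℝ} {μ : Measure (Conf S)} [IsProbabilityMeasure μ]
    (h : GibbsCond φ μ) {Λ : Finset ℤ} (hΛ : Λ.Nonempty) {B : Set (Conf S)}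
    (hB : MeasurableSet B) :
    Integrable (fiberSum Λ fun y => φ Λ y * B.indicator 1 y) μ ∧
      ∫ x, fiberSum Λ (fun y => φ Λ y * B.indicator 1 y) x ∂μ = μ.real B := by
  have hpre : ∀ ζ : Λ → S, MeasurableSet[cylSA ((Λ : Set ℤ)ᶜ)] ((fun x => ov x Λ ζ) ⁻¹' B) :=
    fun ζ => measurable_ov Λ ζ hB
  have hpre' : ∀ ζ : Λ → S, MeasurableSet ((fun x => ov x Λ ζ) ⁻¹' B) := fun ζ =>
    cylSA_le _ _ (hpre ζ)
  have heq : ∀ ζ : Λ → S, (fun x => φ Λ (ov x Λ ζ) * B.indicator 1 (ov x Λ ζ)) =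
      ((fun x => ov x Λ ζ) ⁻¹' B).indicator fun x => φ Λ (ov x Λ ζ) := fun ζ => by
    funext x
    by_cases hx : ov x Λ ζ ∈ B
    · rw [Set.indicator_of_mem hx,
        Set.indicator_of_mem (show x ∈ (fun x => ov x Λ ζ) ⁻¹' B from hx)]
      simp
    · rw [Set.indicator_of_notMem hx,
        Set.indicator_of_notMem (show x ∉ (fun x => ov x Λ ζ) ⁻¹' B from hx), mul_zero]
  have hint : ∀ ζ : Λ → S,
      Integrable (fun x => φ Λ (ov x Λ ζ) * B.indicator 1 (ov x Λ ζ)) μ := fun ζ => by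
    rw [heq]
    exact (integrable_condExp.congr (h Λ hΛ ζ).symm).indicator (hpre' ζ)
  refine ⟨integrable_finsetSum _ fun ζ _ => hint ζ, ?_⟩
  have hval : ∀ ζ : Λ → S, ∫ x, φ Λ (ov x Λ ζ) * B.indicator 1 (ov x Λ ζ) ∂μ =
      ∫ x, B.indicator 1 x * (cylEvent Λ ζ).indicator 1 x ∂μ := fun ζ => by
    rw [heq, integral_indicator (hpre' ζ),
      setIntegral_congr_ae (hpre' ζ) ((h Λ hΛ ζ).mono fun x hx _ => hx),
      setIntegral_condExp (cylSA_le _)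
        ((integrable_const (1 : ℝ)).indicator (measurableSet_cylEvent Λ ζ)) (hpre ζ),
      ← integral_indicator (hpre' ζ)]
    refine integral_congr_ae (Eventually.of_forall fun x => ?_)
    by_cases hx : x ∈ cylEvent Λ ζ
    · by_cases hxB : x ∈ B <;> simp [Set.indicator, hx, hxB, ov_eq_self_of_mem hx]
    · simp [Set.indicator, hx]
  have hsum : ∀ x : Conf S, ∑ ζ : Λ → S, (cylEvent Λ ζ).indicator (1 : Conf S → ℝ) x = 1 := by
    classical
    intro x
    rw [Finset.sum_eq_single (fun i : Λ => x i)]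
    · exact Set.indicator_of_mem (show x ∈ cylEvent Λ _ from fun i => rfl) _
    · exact fun ζ _ hζ => Set.indicator_of_notMem (fun hx => hζ (funext fun i => (hx i).symm)) _
    · simp
  simp only [fiberSum]
  rw [integral_finsetSum _ fun ζ _ => hint ζ, Finset.sum_congr rfl fun ζ _ => hval ζ,
    ← integral_finsetSum]
  · simp_rw [← Finset.mul_sum, hsum, mul_one]
    exact integral_indicator_one hB
  · refine fun ζ _ => Integrable.mul_of_top_left ?_ ?_
    · exact (integrable_const (1 : ℝ)).indicator hB
    · exact (memLp_top_const (1 : ℝ)).indicator (measurableSet_cylEvent Λ ζ)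

/-- Uniform mixing implies that there is at most one Gibbs state. -/
lemma IsGibbsPot.unique [Fintype S] [Nonempty S] [MeasurableSingletonClass S] {P : Potential S}
    {δ : ℝ} (hδ : 0 < δ)
    (h : ∀ W : Finset ℤ, ∃ V : Finset ℤ, V.Nonempty ∧ ∀ f : Conf S → ℝ, (∀ x, 0 ≤ f x) →
      (∀ x, f x ≤ 1) → (∀ x y, (∀ i ∈ W, x i = y i) → f x = f y) →
      (∀ x, δ ≤ gibbsAvg P V f x) ∨ ∀ x, δ ≤ gibbsAvg P V (fun y => 1 - f y) x)
    {μ ν : Measure (Conf S)} (hμ : IsGibbsPot P μ) (hν : IsGibbsPot P ν) : μ = ν := by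
  have := hμ.1
  have := hν.1
  refine eq_of_forall_mem_setAlgebra isSetAlgebra_measurableCylinders
    generateFrom_measurableCylinders.symm hδ fun B hB => ?_
  have hBm := MeasurableSet.of_mem_measurableCylinders hB
  obtain ⟨W, D, -, hWD⟩ := (mem_measurableCylinders B).1 hB
  obtain ⟨V, hV, hf⟩ := h W
  obtain ⟨f, hfB⟩ : ∃ f : Conf S → ℝ, f = B.indicator 1 := ⟨_, rfl⟩
  have h0 : ∀ x, 0 ≤ f x := fun x => by
    rw [hfB]
    exact Set.indicator_nonneg (fun _ _ => zero_le_one) x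
  have h1 : ∀ x, f x ≤ 1 := fun x => by
    rw [hfB]
    exact Set.indicator_le_self' (fun _ _ => zero_le_one) x
  have hloc : ∀ x y, (∀ i ∈ W, x i = y i) → f x = f y := fun x y hxy => by
    have hiff : x ∈ B ↔ y ∈ B := by
      rw [hWD, mem_cylinder, mem_cylinder,
        show W.restrict x = W.restrict y from funext fun i => hxy i i.2]
    by_cases hx : x ∈ B
    · rw [hfB, Set.indicator_of_mem hx, Set.indicator_of_mem (hiff.1 hx)]
      rfl
    · rw [hfB, Set.indicator_of_notMem hx, Set.indicator_of_notMem (mt hiff.2 hx)]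
  have hg0 : ∀ x, 0 ≤ gibbsAvg P V f x :=
    fiberSum_nonneg fun y => mul_nonneg (potPhi_pos V y).le (h0 y)
  have hg1 : ∀ x, 0 ≤ gibbsAvg P V (fun y => 1 - f y) x :=
    fiberSum_nonneg fun y => mul_nonneg (potPhi_pos V y).le (sub_nonneg.2 (h1 y))
  have hdlr : ∀ {ρ : Measure (Conf S)} [IsProbabilityMeasure ρ], IsGibbsPot P ρ →
      Integrable (gibbsAvg P V f) ρ ∧ ∫ x, gibbsAvg P V f x ∂ρ = ρ.real B := by
    intro ρ _ hρ
    rw [hfB]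
    exact hρ.2.integral_fiberSum hV hBm
  specialize hf f h0 h1 hloc
  simp only [gibbsAvg_one_sub] at hf hg1
  rcases hf with hf | hf
  · exact ⟨gibbsAvg P V f, δ, (hdlr hμ).1, (hdlr hν).1, hf, fun x => by linarith [hg1 x],
      (hdlr hμ).2, (hdlr hν).2⟩
  · exact ⟨gibbsAvg P V f, 0, (hdlr hμ).1, (hdlr hν).1, hg0, fun x => by linarith [hf x],
      (hdlr hμ).2, (hdlr hν).2⟩

end Uniqueness

section Consistency

variable {S : Type} [Fintype S] [MeasurableSpace S] {P : Potential S}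

lemma HPot_sub_HPot (hP : NormSummable P) {Λ V : Finset ℤ} (hΛ : Λ ⊆ V) {x y : Conf S}
    (h : ∀ i ∉ Λ, x i = y i) : HPot P V x - HPot P V y = HPot P Λ x - HPot P Λ y := by
  have hsub : ∀ W : Finset ℤ, HPot P W x - HPot P W y =
      ∑' K : Finset ℤ, {K : Finset ℤ | (K ∩ W).Nonempty}.indicator
        (fun K => P.Φ K x - P.Φ K y) K := fun W => by
    rw [HPot, HPot, ← (summable_HPot hP W x).tsum_sub (summable_HPot hP W y), ← tsum_subtype]
    rfl
  rw [hsub, hsub]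
  refine tsum_congr fun K => ?_
  by_cases hK : (K ∩ Λ).Nonempty
  · rw [Set.indicator_of_mem (show K ∈ {K : Finset ℤ | (K ∩ Λ).Nonempty} from hK),
      Set.indicator_of_mem (show K ∈ {K : Finset ℤ | (K ∩ V).Nonempty} from
        hK.mono (Finset.inter_subset_inter_left hΛ))]
  · rw [Set.indicator_of_notMem (show K ∉ {K : Finset ℤ | (K ∩ Λ).Nonempty} from hK)]
    refine Set.indicator_apply_eq_zero.2 fun hKV => sub_eq_zero.2 ?_
    have hKV : (K ∩ V).Nonempty := hKV
    exact P.congr (hKV.mono Finset.inter_subset_left) fun i hi => h i fun hiΛ =>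
      hK ⟨i, Finset.mem_inter.2 ⟨hi, hiΛ⟩⟩

lemma gibbsAvg_congr {V : Finset ℤ} (f : Conf S → ℝ) {x y : Conf S} (h : ∀ i ∉ V, x i = y i) :
    gibbsAvg P V f x = gibbsAvg P V f y := fiberSum_congr _ h

/-- Consistency of the finite-volume Gibbs measures. -/
lemma gibbsAvg_gibbsAvg [Nonempty S] (hP : NormSummable P) {Λ V : Finset ℤ} (hΛ : Λ ⊆ V)
    (f : Conf S → ℝ) (x : Conf S) : gibbsAvg P V (gibbsAvg P Λ f) x = gibbsAvg P V f x := by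
  rw [gibbsAvg_eq, gibbsAvg_eq]
  congr 1
  obtain ⟨w, hw⟩ : ∃ w : Conf S → ℝ, ∀ y, w y = Real.exp (HPot P Λ y - HPot P V y) :=
    ⟨_, fun _ => rfl⟩
  have hwc : ∀ y z : Conf S, (∀ i ∉ Λ, y i = z i) → w y = w z := fun y z h => by
    have := HPot_sub_HPot hP hΛ h
    rw [hw, hw]
    congr 1
    linarith
  have hexp : ∀ y, Real.exp (-HPot P V y) = w y * Real.exp (-HPot P Λ y) := fun y => by
    rw [hw, ← Real.exp_add]
    congr 1
    ring
  have hcard : (Fintype.card (Λ → S) : ℝ) ≠ 0 := Nat.cast_ne_zero.2 Fintype.card_ne_zero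
  refine mul_left_cancel₀ hcard ?_
  rw [← fiberSum_fiberSum hΛ, ← fiberSum_fiberSum hΛ]
  congr 1
  funext z
  have e1 : (fun y => gibbsAvg P Λ f y * Real.exp (-HPot P V y)) =
      fun y => (gibbsAvg P Λ f y * w y) * Real.exp (-HPot P Λ y) := by
    funext y
    rw [hexp, mul_assoc]
  have e2 : (fun y => f y * Real.exp (-HPot P V y)) =
      fun y => w y * (f y * Real.exp (-HPot P Λ y)) := by
    funext y
    rw [hexp, mul_left_comm]
  rw [e1, e2, fiberSum_mul_left fun y z h => by rw [gibbsAvg_congr f h, hwc y z h],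
    fiberSum_mul_left hwc, gibbsAvg_eq]
  have := (partition_pos (P := P) Λ z).ne'
  change _ * partition P Λ z = _
  field_simp

end Consistency

section Existence

variable {S : Type} [Fintype S] [TopologicalSpace S] [DiscreteTopology S] [MeasurableSpace S]
  {P : Potential S}

omit [Fintype S] [DiscreteTopology S] [MeasurableSpace S] in
lemma continuous_ov (Λ : Finset ℤ) (ζ : Λ → S) : Continuous fun x : Conf S => ov x Λ ζ := by
  refine continuous_pi fun i => ?_
  by_cases hi : i ∈ Λ
  · simp only [ov_of_mem _ _ hi]
    exact continuous_const
  · simp only [ov_of_notMem _ _ hi]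
    exact continuous_apply i

omit [Fintype S] [MeasurableSpace S] in
lemma continuous_of_local {K : Finset ℤ} {f : Conf S → ℝ}
    (h : ∀ x y : Conf S, (∀ i ∈ K, x i = y i) → f x = f y) : Continuous f := by
  refine continuous_iff_continuousAt.2 fun x => ?_
  have hx : {y : Conf S | ∀ i ∈ K, y i = x i} ∈ nhds x := by
    have : {y : Conf S | ∀ i ∈ K, y i = x i} = ⋂ i ∈ K, (fun y : Conf S => y i) ⁻¹' {x i} := by
      ext y
      simp
    rw [this]
    exact (isOpen_biInter_finset fun i _ =>
      (isOpen_discrete _).preimage (continuous_apply i)).mem_nhds (by simp)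
  exact continuousAt_const.congr (Filter.eventually_of_mem hx fun y hy => (h y x hy).symm)

lemma continuous_HPot (hP : NormSummable P) (V : Finset ℤ) : Continuous (HPot P V) :=
  continuous_tsum (fun K => continuous_of_local fun _ _ h =>
    P.congr (K.2.mono Finset.inter_subset_left) h) (summable_pnorm_of_inter hP V)
    fun K x => P.abs_le_pnorm K x

lemma continuous_potPhi [Nonempty S] (hP : NormSummable P) (V : Finset ℤ) :
    Continuous (potPhi P V) := by
  have h := Real.continuous_exp.comp (continuous_HPot hP V).neg
  exact h.div (continuous_finsetSum _ fun ζ _ => h.comp (continuous_ov V ζ))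
    fun x => (partition_pos V x).ne'

lemma continuous_gibbsAvg [Nonempty S] (hP : NormSummable P) (V : Finset ℤ) {f : Conf S → ℝ}
    (hf : Continuous f) : Continuous (gibbsAvg P V f) :=
  continuous_finsetSum _ fun ζ _ =>
    ((continuous_potPhi hP V).mul hf).comp (continuous_ov V ζ)

/-- The measure obtained from `μ` by resampling the configuration inside `V`. -/
def resample (P : Potential S) (V : Finset ℤ) (μ : Measure (Conf S)) : Measure (Conf S) :=
  ∑ ζ : V → S, (μ.withDensity fun x => ENNReal.ofReal (potPhi P V (ov x V ζ))).map
    fun x => ov x V ζ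

variable [MeasurableSingletonClass S]

lemma measurable_potPhi_ov [Nonempty S] (hP : NormSummable P) (V : Finset ℤ) (ζ : V → S) :
    Measurable fun x => potPhi P V (ov x V ζ) :=
  ((continuous_potPhi hP V).comp (continuous_ov V ζ)).measurable

omit [TopologicalSpace S] [DiscreteTopology S] [MeasurableSingletonClass S] in
lemma potPhi_le_one [Nonempty S] (V : Finset ℤ) (x : Conf S) (ζ : V → S) :
    potPhi P V (ov x V ζ) ≤ 1 := by
  have h : fiberSum V (fun y => potPhi P V y * 1) x = 1 := gibbsAvg_one (P := P) V x
  simp only [mul_one] at h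
  rw [← h]
  exact Finset.single_le_sum (f := fun ξ => potPhi P V (ov x V ξ))
    (fun ξ _ => (potPhi_pos V _).le) (Finset.mem_univ ζ)

lemma integrable_potPhi_ov [Nonempty S] (hP : NormSummable P) (V : Finset ℤ)
    (μ : Measure (Conf S)) [IsFiniteMeasure μ] (ζ : V → S) :
    Integrable (fun x => potPhi P V (ov x V ζ)) μ :=
  Integrable.of_bound (measurable_potPhi_ov hP V ζ).aestronglyMeasurable 1
    (Eventually.of_forall fun x => by
      rw [Real.norm_of_nonneg (potPhi_pos V _).le]
      exact potPhi_le_one V x ζ)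

lemma isFiniteMeasure_resample [Nonempty S] (hP : NormSummable P) (V : Finset ℤ)
    (μ : Measure (Conf S)) [IsFiniteMeasure μ] : IsFiniteMeasure (resample P V μ) := by
  have h : ∀ ζ : V → S, IsFiniteMeasure
      (μ.withDensity fun x => ENNReal.ofReal (potPhi P V (ov x V ζ))) := fun ζ =>
    isFiniteMeasure_withDensity_ofReal (integrable_potPhi_ov hP V μ ζ).2
  unfold resample
  infer_instance

lemma integral_resample [Nonempty S] (hP : NormSummable P) (V : Finset ℤ) (μ : Measure (Conf S))
    [IsFiniteMeasure μ] {f : Conf S → ℝ} (hf : Measurable f) (hb : ∃ C, ∀ x, |f x| ≤ C) :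
    ∫ x, f x ∂(resample P V μ) = ∫ x, gibbsAvg P V f x ∂μ := by
  obtain ⟨C, hC⟩ := hb
  have h : ∀ ζ : V → S, IsFiniteMeasure
      (μ.withDensity fun x => ENNReal.ofReal (potPhi P V (ov x V ζ))) := fun ζ =>
    isFiniteMeasure_withDensity_ofReal (integrable_potPhi_ov hP V μ ζ).2
  have hov : ∀ ζ : V → S, Measurable fun x => ov x V ζ := fun ζ => (continuous_ov V ζ).measurable
  unfold resample
  rw [integral_finsetSum_measure fun ζ _ =>
    Integrable.of_bound hf.aestronglyMeasurable C (Eventually.of_forall hC)]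
  simp only [gibbsAvg, fiberSum]
  rw [integral_finsetSum]
  · refine Finset.sum_congr rfl fun ζ _ => ?_
    rw [integral_map (hov ζ).aemeasurable hf.aestronglyMeasurable,
      integral_withDensity_eq_integral_toReal_smul
        (measurable_potPhi_ov hP V ζ).ennreal_ofReal (Eventually.of_forall fun x =>
          ENNReal.ofReal_lt_top)]
    refine integral_congr_ae (Eventually.of_forall fun x => ?_)
    simp only [smul_eq_mul, ENNReal.toReal_ofReal (potPhi_pos (P := P) V _).le]
  · exact fun ζ _ => (integrable_potPhi_ov hP V μ ζ).mul_bdd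
      (hf.comp (hov ζ)).aestronglyMeasurable (c := C) (Eventually.of_forall fun x => hC _)

lemma isProbabilityMeasure_resample [Nonempty S] (hP : NormSummable P) (V : Finset ℤ)
    (μ : Measure (Conf S)) [IsProbabilityMeasure μ] : IsProbabilityMeasure (resample P V μ) := by
  have := isFiniteMeasure_resample hP V μ
  have h := integral_resample hP V μ (f := fun _ => 1) measurable_const ⟨1, fun _ => by simp⟩
  simp only [gibbsAvg_one, integral_const, probReal_univ, smul_eq_mul, mul_one] at h
  exact ⟨(ENNReal.toReal_eq_one_iff _).1 h⟩

/-- A probability measure which is invariant under resampling is a Gibbs state. -/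
lemma isGibbsPot_of_resample [Nonempty S] (hP : NormSummable P) {μ : Measure (Conf S)}
    [IsProbabilityMeasure μ] (h : ∀ Λ : Finset ℤ, Λ.Nonempty → resample P Λ μ = μ) :
    IsGibbsPot P μ := by
  classical
  refine ⟨inferInstance, fun Λ hΛ ζ => ?_⟩
  have hint := integrable_potPhi_ov hP Λ μ ζ
  refine ae_eq_condExp_of_forall_setIntegral_eq (cylSA_le _)
    ((integrable_const (1 : ℝ)).indicator (measurableSet_cylEvent Λ ζ))
    (fun _ _ _ => hint.integrableOn) (fun B hB _ => ?_) ?_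
  · have hBm := cylSA_le _ B hB
    have hBζ := hBm.inter (measurableSet_cylEvent Λ ζ)
    obtain ⟨f, hf⟩ : ∃ f : Conf S → ℝ, f = (B ∩ cylEvent Λ ζ).indicator 1 := ⟨_, rfl⟩
    have hfm : Measurable f := hf ▸ measurable_one.indicator hBζ
    have hfb : ∀ x, |f x| ≤ 1 := fun x => by
      rw [hf]
      by_cases hx : x ∈ B ∩ cylEvent Λ ζ <;> simp [Set.indicator, hx]
    have h1 := integral_resample hP Λ μ hfm ⟨1, hfb⟩
    rw [h Λ hΛ] at h1
    have hBov : ∀ x, ov x Λ ζ ∈ B ↔ x ∈ B := by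
      obtain ⟨D, -, rfl⟩ := hB
      intro x
      have hres : (Λ : Set ℤ)ᶜ.domRestrict (ov x Λ ζ) = (Λ : Set ℤ)ᶜ.domRestrict x :=
        funext fun i => ov_of_notMem _ _ fun hi => i.2 (Finset.mem_coe.2 hi)
      change (Λ : Set ℤ)ᶜ.domRestrict (ov x Λ ζ) ∈ D ↔ (Λ : Set ℤ)ᶜ.domRestrict x ∈ D
      rw [hres]
    have h2 : gibbsAvg P Λ f = B.indicator fun x => potPhi P Λ (ov x Λ ζ) := by
      funext x
      rw [gibbsAvg, fiberSum, Finset.sum_eq_single ζ]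
      · have hmem : ov x Λ ζ ∈ cylEvent Λ ζ := fun i => ov_of_mem _ _ i.2
        by_cases hx : x ∈ B
        · simp [hf, Set.indicator, hx, hBov, hmem]
        · simp [hf, Set.indicator, hx, hBov]
      · intro ξ _ hξ
        have hmem : ov x Λ ξ ∉ cylEvent Λ ζ := fun hmem => hξ <| funext fun i => by
          rw [← hmem i, ov_of_mem _ _ i.2]
        simp [hf, hmem]
      · simp
    rw [h2, integral_indicator hBm] at h1
    rw [← h1, hf, ← integral_indicator hBm, ← Set.indicator_indicator]
    rfl
  · have h0 : (fun x => potPhi P Λ (ov x Λ ζ)) = (potPhi P Λ) ∘ fun x => ov x Λ ζ := rfl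
    rw [h0]
    exact ((continuous_potPhi hP Λ).measurable.comp
      (measurable_ov Λ ζ)).stronglyMeasurable.aestronglyMeasurable

lemma exists_isGibbsPot [Nonempty S] (hP : NormSummable P) : ∃ μ, IsGibbsPot P μ := by
  obtain ⟨η⟩ : Nonempty (Conf S) := inferInstance
  let π : Finset ℤ → ProbabilityMeasure (Conf S) := fun V =>
    ⟨resample P V (Measure.dirac η), isProbabilityMeasure_resample hP V _⟩
  have hπ : ∀ (V : Finset ℤ) {f : Conf S → ℝ}, Continuous f → (∃ C, ∀ x, |f x| ≤ C) →
      ∫ x, f x ∂(π V : Measure (Conf S)) = gibbsAvg P V f η := fun V f hf hb => by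
    rw [← integral_dirac (gibbsAvg P V f) η]
    exact integral_resample hP V _ hf.measurable hb
  let u : Ultrafilter (Finset ℤ) := Ultrafilter.of atTop
  obtain ⟨μ, -, hμ⟩ := isCompact_univ.ultrafilter_le_nhds (u.map π) (by simp)
  have hlim := ProbabilityMeasure.tendsto_iff_forall_integral_tendsto.1
    (show Tendsto π u (nhds μ) from hμ)
  refine ⟨μ, isGibbsPot_of_resample hP fun Λ _ => ?_⟩
  have := isFiniteMeasure_resample hP Λ (μ : Measure (Conf S))
  refine ext_of_forall_integral_eq_of_IsFiniteMeasure fun f => ?_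
  have hb : ∃ C, ∀ x, |f x| ≤ C := ⟨‖f‖, f.norm_coe_le_norm⟩
  rw [integral_resample hP Λ _ f.continuous.measurable hb]
  let g : BoundedContinuousFunction (Conf S) ℝ :=
    BoundedContinuousFunction.mkOfCompact ⟨gibbsAvg P Λ f, continuous_gibbsAvg hP Λ f.continuous⟩
  refine tendsto_nhds_unique ((hlim g).congr' ?_) (hlim f)
  refine Filter.Eventually.filter_mono (Ultrafilter.of_le _)
    ((eventually_ge_atTop Λ).mono fun V hV => ?_)
  refine (hπ V g.continuous ⟨‖g‖, g.norm_coe_le_norm⟩).trans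
    (Eq.trans ?_ (hπ V f.continuous hb).symm)
  exact gibbsAvg_gibbsAvg hP hV f η

end Existence

section ShiftInvariance

variable {S : Type} [Fintype S]

/-- Translation of configurations on a finite set. -/
def translateEquiv (S : Type) (n : ℤ) (Λ : Finset ℤ) :
    (Λ.image (fun i => n + i) → S) ≃ (Λ → S) :=
  Equiv.arrowCongr (((Equiv.addLeft n).subtypeEquiv fun i => by
    rw [mem_translate]
    simp).symm : {j // j ∈ Λ.image fun i => n + i} ≃ {i // i ∈ Λ}) (Equiv.refl S)

lemma fiberSum_translate (n : ℤ) (Λ : Finset ℤ) (F : Conf S → ℝ) (x : Conf S) :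
    fiberSum (Λ.image fun i => n + i) (fun y => F (shift n y)) x = fiberSum Λ F (shift n x) := by
  refine Fintype.sum_equiv (translateEquiv S n Λ) _ _ fun ζ => congrArg F ?_
  funext i
  by_cases hi : i ∈ Λ
  · have hi' : i + n ∈ Λ.image fun i => n + i := mem_translate.2 (by simpa using hi)
    rw [ov_of_mem _ _ hi, shift, ov_of_mem _ _ hi']
    exact congrArg ζ (Subtype.ext (add_comm i n))
  · have hi' : i + n ∉ Λ.image fun i => n + i := fun h => hi (by simpa using mem_translate.1 h)
    rw [ov_of_notMem _ _ hi, shift, ov_of_notMem _ _ hi']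
    rfl

variable [MeasurableSpace S] {P : Potential S}

lemma HPot_translate (n : ℤ) (Λ : Finset ℤ) (x : Conf S) :
    HPot P (Λ.image fun i => n + i) x = HPot P Λ (shift n x) := by
  have himage : ∀ K : Finset ℤ, (Equiv.addLeft n).finsetCongr K = K.image fun i => n + i :=
    fun K => by
      rw [Equiv.finsetCongr_apply, Finset.map_eq_image]
      rfl
  let e : {K : Finset ℤ // (K ∩ Λ).Nonempty} ≃
      {K : Finset ℤ // (K ∩ Λ.image fun i => n + i).Nonempty} :=
    (Equiv.addLeft n).finsetCongr.subtypeEquiv fun K => by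
      rw [himage, ← Finset.image_inter _ _ (add_right_injective n), Finset.image_nonempty]
  rw [HPot, HPot, ← e.tsum_eq]
  refine tsum_congr fun K => ?_
  rw [← P.invariant n K (K.2.mono Finset.inter_subset_left)]
  exact congrArg (fun L => P.Φ L x) (himage K)

lemma potPhi_translate (n : ℤ) (Λ : Finset ℤ) (x : Conf S) :
    potPhi P (Λ.image fun i => n + i) x = potPhi P Λ (shift n x) := by
  rw [potPhi_eq, potPhi_eq, HPot_translate, partition, partition, ← fiberSum_translate]
  simp only [HPot_translate]

lemma gibbsAvg_translate (n : ℤ) (Λ : Finset ℤ) (f : Conf S → ℝ) (x : Conf S) :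
    gibbsAvg P (Λ.image fun i => n + i) (fun y => f (shift n y)) x =
      gibbsAvg P Λ f (shift n x) := by
  rw [gibbsAvg, gibbsAvg, ← fiberSum_translate]
  simp only [potPhi_translate]

lemma measurable_shift {S : Type} [MeasurableSpace S] (n : ℤ) :
    Measurable (shift n : Conf S → Conf S) :=
  measurable_pi_lambda _ fun i => measurable_pi_apply (i + n)

lemma IsGibbsPot.map_shift [Nonempty S] [MeasurableSingletonClass S] (hP : NormSummable P)
    {μ : Measure (Conf S)} (hμ : IsGibbsPot P μ) (n : ℤ) : IsGibbsPot P (μ.map (shift n)) := by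
  let _ : TopologicalSpace S := ⊥
  have : DiscreteTopology S := ⟨rfl⟩
  have := hμ.1
  have : IsProbabilityMeasure (μ.map (shift n)) :=
    Measure.isProbabilityMeasure_map (measurable_shift n).aemeasurable
  refine isGibbsPot_of_resample hP fun Λ hΛ => Measure.ext fun B hB => ?_
  have := isFiniteMeasure_resample hP Λ (μ.map (shift n))
  have hbound : ∀ x, |B.indicator (1 : Conf S → ℝ) x| ≤ 1 := fun x => by
    by_cases hx : x ∈ B <;> simp [hx]
  have hgm : Measurable (gibbsAvg P Λ (B.indicator 1)) :=
    Finset.measurable_sum _ fun ζ _ => ((continuous_potPhi hP Λ).measurable.mul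
      (measurable_one.indicator hB)).comp (continuous_ov Λ ζ).measurable
  have h1 := integral_resample hP Λ (μ.map (shift n)) (measurable_one.indicator hB) ⟨1, hbound⟩
  have h2 := (hμ.2.integral_fiberSum (hΛ.image fun i => n + i) (measurable_shift n hB)).2
  have h3 : ∀ x, gibbsAvg P Λ (B.indicator 1) (shift n x) =
      gibbsAvg P (Λ.image fun i => n + i) ((shift n ⁻¹' B).indicator 1) x := fun x => by
    rw [← gibbsAvg_translate]
    rfl
  rw [integral_indicator_one hB, integral_map (measurable_shift n).aemeasurable
    hgm.aestronglyMeasurable, integral_congr_ae (Eventually.of_forall h3)] at h1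
  have h4 := h1.trans h2
  rw [← map_measureReal_apply (measurable_shift n) hB] at h4
  exact (measureReal_eq_measureReal_iff).1 h4

end ShiftInvariance

/-- The potential version of Theorem 6.1: under the logarithmic bound on the summed
tail variations and the `n^{1/2}` smallness condition, the potential has a unique
`T`-invariant Gibbs state. -/
theorem unique_invariant_gibbs_of_potential
    {S : Type} [Fintype S] [Nonempty S] [DecidableEq S]
    [TopologicalSpace S] [DiscreteTopology S]
    [MeasurableSpace S] [MeasurableSingletonClass S]
    (P : Potential S) (hsum : NormSummable P)
    (K α : ℝ) (hK0 : 0 < K) (hα0 : 0 < α) (hα1 : α ≤ 1)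
    (h1 : ∀ n : ℕ, 1 ≤ n →
      ∑ i ∈ Finset.range (n + 1), varTail P (i + 1) ≤ (1 - α) * Real.log n + Real.log K)
    (h2 : limsup (fun n : ℕ => (n : ℝ) ^ ((1 : ℝ) / 2) * varTail P (n + 1) ^ α) atTop
      < K⁻¹ * Real.Gamma α) :
    ∃! μ : Measure (Conf S), IsGibbsPot P μ ∧ μ.map (shift 1) = μ := by
  obtain ⟨δ, hδ, hmix⟩ := exists_le_gibbsAvg hsum hK0 hα0 hα1 h1
  obtain ⟨μ, hμ⟩ := exists_isGibbsPot hsum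
  exact ⟨μ, ⟨hμ, IsGibbsPot.unique hδ hmix (hμ.map_shift hsum 1) hμ⟩,
    fun ν hν => IsGibbsPot.unique hδ hmix hν.1 hμ⟩
end GibbsFormal
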